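/- Suppose β₁ > 1, and suppose that for every fixed μ > 0 and σ > 0 the map β₂ ↦ α_{2|1}(μ, σ; β₁, β₂) := α₁₂(μ, σ; β₁, β₂)/α₁(μ; β₁, β₂) is antitone (non-increasing) on [β₁, ∞). Then for every β₂ ≥ β₁, every μ > 0, σ > 0 and η > 0, Eff(μ, σ²; β₁, β₂, η) ≤ (1/β₁) · sup_{μ' > 0, σ' > 0} Eff_PM(μ', σ'²), where Eff_PM(μ, σ²) := 2μ²σ² Φ( −√(μ² + 2σ²)/2 ). -/

import Mathlib

open MeasureTheory ProbabilityTheory Real Filter Set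
open scoped Topology

/-- The Metropolis–Hastings accept-reject function `F(u) = min(1, eᵘ)`. -/
noncomputable def Facc (u : ℝ) : ℝ := min 1 (Real.exp u)

/-- The law of the limiting bivariate Gaussian pair `(Q∞, S∞)` with
`Q∞ ~ N(−μ²/2, μ²)`, `S∞ ~ N(β₁μ²/2, β₂²μ²)` and `Cov(Q∞, S∞) = −β₁μ²`
(valid whenever `|β₁| ≤ β₂`), realised as the image of two independent
standard Gaussians. -/
noncomputable def QSmeas (μ β₁ β₂ : ℝ) : Measure (ℝ × ℝ) :=
  Measure.map
    (fun z : ℝ × ℝ =>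
      (-μ ^ 2 / 2 + μ * z.1,
        β₁ * μ ^ 2 / 2 + μ * (-(β₁ * z.1) + Real.sqrt (β₂ ^ 2 - β₁ ^ 2) * z.2)))
    ((gaussianReal 0 1).prod (gaussianReal 0 1))

/-- Law of `W_Δ = W* − W ~ N(−σ², 2σ²)` under the Gaussian noise assumption. -/
noncomputable def gaussNoise (σ : ℝ) : Measure ℝ :=
  gaussianReal (-σ ^ 2) (Real.toNNReal (2 * σ ^ 2))

/-- Limiting Stage One acceptance rate `α₁(μ; β₁, β₂) = E[F(Q∞ + S∞)]`. -/
noncomputable def alpha1 (μ β₁ β₂ : ℝ) : ℝ :=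
  ∫ p : ℝ × ℝ, Facc (p.1 + p.2) ∂(QSmeas μ β₁ β₂)

/-- Limiting overall acceptance rate `α₁₂(μ, σ; β₁, β₂) = E[F(Q∞ + S∞)·F(W_Δ − S∞)]`. -/
noncomputable def alpha12 (μ σ β₁ β₂ : ℝ) : ℝ :=
  ∫ p : (ℝ × ℝ) × ℝ, Facc (p.1.1 + p.1.2) * Facc (p.2 - p.1.2)
    ∂((QSmeas μ β₁ β₂).prod (gaussNoise σ))

/-- Standard normal cumulative distribution function `Φ`. -/
noncomputable def stdPhi (x : ℝ) : ℝ := ((gaussianReal 0 1) (Set.Iic x)).toReal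

/-- The efficiency functional `Eff(μ, σ²) = μ² σ² α₁₂(μ, σ) / (η σ² + α₁(μ))`,
written as a function of `v = σ²`. -/
noncomputable def Eff (η μ β₁ β₂ v : ℝ) : ℝ :=
  μ ^ 2 * v * alpha12 μ (Real.sqrt v) β₁ β₂ / (η * v + alpha1 μ β₁ β₂)

/-- The efficiency functional of the pseudo-marginal RWM,
`Eff_PM(μ, σ²) = 2μ²σ²Φ(−√(μ² + 2σ²)/2)`, as a function of `μ` and `v = σ²`. -/
noncomputable def EffPM (μ v : ℝ) : ℝ :=
  2 * μ ^ 2 * v * stdPhi (-(Real.sqrt (μ ^ 2 + 2 * v)) / 2)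

/-- The `n`-th moment `∫₀^∞ tⁿ exp(-u t - t²/2) dt`; for `n = 0` this is the Mills ratio. -/
noncomputable def millsMoment (n : ℕ) (u : ℝ) : ℝ :=
  ∫ t in Ioi (0 : ℝ), t ^ n * exp (-(u * t) - t ^ 2 / 2)

/-- The Mills ratio `R(u) = ∫₀^∞ exp(-u t - t²/2) dt`. -/
noncomputable def mills (u : ℝ) : ℝ := millsMoment 0 u

theorem exp_linear_sub_sq_le (u t : ℝ) :
    exp (-(u * t) - t ^ 2 / 2) ≤ exp (u ^ 2) * exp (-(1 / 4) * t ^ 2) := by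
  rw [← exp_add]
  exact exp_le_exp.2 (by nlinarith [sq_nonneg (t / 2 + u)])

theorem integrableOn_pow_mul_exp_quarter (n : ℕ) :
    IntegrableOn (fun t : ℝ => t ^ n * exp (-(1 / 4) * t ^ 2)) (Ioi 0) := by
  have h := integrableOn_rpow_mul_exp_neg_mul_sq (b := 1 / 4) (by norm_num) (s := n)
    (by have : (0 : ℝ) ≤ n := n.cast_nonneg
        linarith)
  simpa [rpow_natCast] using h

theorem integrableOn_millsMoment (n : ℕ) (u : ℝ) :
    IntegrableOn (fun t : ℝ => t ^ n * exp (-(u * t) - t ^ 2 / 2)) (Ioi 0) := by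
  refine ((integrableOn_pow_mul_exp_quarter n).const_mul (exp (u ^ 2))).mono'
    (by fun_prop) ?_
  filter_upwards [ae_restrict_mem measurableSet_Ioi] with t ht
  have ht' : (0 : ℝ) ≤ t ^ n := pow_nonneg (le_of_lt ht) n
  rw [norm_mul, norm_of_nonneg ht', norm_of_nonneg (exp_pos _).le]
  nlinarith [mul_le_mul_of_nonneg_left (exp_linear_sub_sq_le u t) ht']

theorem hasDerivAt_millsMoment (n : ℕ) (u : ℝ) :
    HasDerivAt (millsMoment n) (-millsMoment (n + 1) u) u := by
  have key := (hasDerivAt_integral_of_dominated_loc_of_deriv_le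
    (μ := volume.restrict (Ioi (0 : ℝ))) (x₀ := u) (s := Metric.ball u 1)
    (F := fun u t : ℝ => t ^ n * exp (-(u * t) - t ^ 2 / 2))
    (F' := fun u t : ℝ => -(t ^ (n + 1) * exp (-(u * t) - t ^ 2 / 2)))
    (bound := fun t : ℝ => t ^ (n + 1) * exp (-((u - 1) * t) - t ^ 2 / 2))
    (Metric.ball_mem_nhds u one_pos)
    (Eventually.of_forall fun v => (integrableOn_millsMoment n v).aestronglyMeasurable)
    (integrableOn_millsMoment n u) (integrableOn_millsMoment (n + 1) u).neg.aestronglyMeasurable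
    ?_ (integrableOn_millsMoment (n + 1) (u - 1)) ?_).2
  · rw [integral_neg] at key
    exact key
  · filter_upwards [ae_restrict_mem measurableSet_Ioi] with t ht v hv
    have ht0 : (0 : ℝ) < t := ht
    have hv' : u - 1 ≤ v := by
      have := abs_lt.1 (Metric.mem_ball.1 hv)
      linarith [this.1]
    rw [norm_neg, norm_of_nonneg (by positivity)]
    gcongr
  · refine Eventually.of_forall fun t v _ => ?_
    have h1 : HasDerivAt (fun v : ℝ => -(v * t) - t ^ 2 / 2) (-t) v := by
      simpa using (((hasDerivAt_id v).mul_const t).neg.sub_const (t ^ 2 / 2))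
    exact (h1.exp.const_mul (t ^ n)).congr_deriv (by ring)

theorem millsMoment_pos (n : ℕ) (u : ℝ) : 0 < millsMoment n u := by
  refine (setIntegral_pos_iff_support_of_nonneg_ae ?_ (integrableOn_millsMoment n u)).2 ?_
  · filter_upwards [ae_restrict_mem measurableSet_Ioi] with t ht
    have ht0 : (0 : ℝ) < t := ht
    show 0 ≤ t ^ n * exp (-(u * t) - t ^ 2 / 2)
    positivity
  · have : Function.support (fun t : ℝ => t ^ n * exp (-(u * t) - t ^ 2 / 2)) ∩ Ioi 0 = Ioi 0 := by
      refine inter_eq_right.2 fun t ht => ?_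
      have ht0 : (0 : ℝ) < t := ht
      exact (by positivity : t ^ n * exp (-(u * t) - t ^ 2 / 2) ≠ 0)
    rw [this]
    simp

theorem tendsto_pow_mul_exp_linear_sub_sq (n : ℕ) (u : ℝ) :
    Tendsto (fun t : ℝ => t ^ n * exp (-(u * t) - t ^ 2 / 2)) atTop (𝓝 0) := by
  refine squeeze_zero' (g := fun t => t ^ n * exp (-t)) ?_ ?_
    (tendsto_pow_mul_exp_neg_atTop_nhds_zero n)
  · filter_upwards [eventually_ge_atTop 0] with t ht
    positivity
  · filter_upwards [eventually_ge_atTop 0, eventually_ge_atTop (2 - 2 * u)] with t ht h2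
    gcongr
    nlinarith

theorem millsMoment_recurrence (n : ℕ) (u : ℝ) :
    n * millsMoment (n - 1) u - u * millsMoment n u - millsMoment (n + 1) u = -0 ^ n := by
  have hd : ∀ t : ℝ, HasDerivAt (fun t : ℝ => t ^ n * exp (-(u * t) - t ^ 2 / 2))
      (n * (t ^ (n - 1) * exp (-(u * t) - t ^ 2 / 2)) - u * (t ^ n * exp (-(u * t) - t ^ 2 / 2))
        - t ^ (n + 1) * exp (-(u * t) - t ^ 2 / 2)) t := by
    intro t
    have h1 : HasDerivAt (fun t : ℝ => -(u * t) - t ^ 2 / 2) (-u - t) t :=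
      (((hasDerivAt_id t).const_mul u).neg.sub ((hasDerivAt_pow 2 t).div_const 2)).congr_deriv
        (by norm_num)
    exact ((hasDerivAt_pow n t).mul h1.exp).congr_deriv (by ring)
  have i1 := (integrableOn_millsMoment (n - 1) u).const_mul (n : ℝ)
  have i2 := (integrableOn_millsMoment n u).const_mul u
  have i12 : Integrable (fun x : ℝ => n * (x ^ (n - 1) * exp (-(u * x) - x ^ 2 / 2))
    - u * (x ^ n * exp (-(u * x) - x ^ 2 / 2))) (volume.restrict (Ioi 0)) := i1.sub i2
  have i3 := integrableOn_millsMoment (n + 1) u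
  have h := integral_Ioi_of_hasDerivAt_of_tendsto' (a := 0) (fun t _ => hd t) (i12.sub i3)
    (tendsto_pow_mul_exp_linear_sub_sq n u)
  simp only [millsMoment]
  rw [← integral_const_mul, ← integral_const_mul, ← integral_sub i1 i2,
    ← integral_sub i12 i3]
  refine h.trans ?_
  simp

theorem millsMoment_one (u : ℝ) : millsMoment 1 u = 1 - u * mills u := by
  have h := millsMoment_recurrence 0 u
  simp only [mills]
  norm_num at h
  linarith

theorem millsMoment_add_two (n : ℕ) (u : ℝ) :
    millsMoment (n + 2) u = (n + 1) * millsMoment n u - u * millsMoment (n + 1) u := by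
  have h := millsMoment_recurrence (n + 1) u
  simp at h
  linarith

theorem mills_pos (u : ℝ) : 0 < mills u := millsMoment_pos 0 u

theorem hasDerivAt_mills (u : ℝ) : HasDerivAt mills (u * mills u - 1) u := by
  refine (hasDerivAt_millsMoment 0 u).congr_deriv ?_
  rw [millsMoment_one]; ring

theorem mul_mills_lt_one (u : ℝ) : u * mills u < 1 := by
  have := millsMoment_pos 1 u
  rw [millsMoment_one] at this
  linarith

theorem millsMoment_two (u : ℝ) : millsMoment 2 u = (1 + u ^ 2) * mills u - u := by
  rw [millsMoment_add_two 0 u, millsMoment_one]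
  simp [mills]; ring

theorem millsMoment_three (u : ℝ) :
    millsMoment 3 u = (u ^ 2 + 2) - (u ^ 3 + 3 * u) * mills u := by
  rw [millsMoment_add_two 1 u, millsMoment_two, millsMoment_one]
  push_cast; ring

theorem millsMoment_four (u : ℝ) :
    millsMoment 4 u = (u ^ 4 + 6 * u ^ 2 + 3) * mills u - (u ^ 3 + 5 * u) := by
  rw [millsMoment_add_two 2 u, millsMoment_three, millsMoment_two]
  push_cast; ring

theorem mills_zero : mills 0 = √(2 * π) / 2 := by
  have h := integral_gaussian_Ioi (1 / 2)
  rw [show π / (1 / 2) = 2 * π by ring] at h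
  rw [← h]
  simp only [mills, millsMoment]
  refine integral_congr_ae (Eventually.of_forall fun t => ?_)
  simp only [pow_zero, one_mul, zero_mul, neg_zero, zero_sub]
  congr 1; ring

theorem mills_antitone : Antitone mills := by
  intro a b hab
  refine setIntegral_mono_on (integrableOn_millsMoment 0 b) (integrableOn_millsMoment 0 a)
    measurableSet_Ioi fun t ht => ?_
  have ht0 : (0 : ℝ) < t := ht
  gcongr

theorem hasDerivAt_neg_sq_half (v : ℝ) : HasDerivAt (fun v : ℝ => -(v ^ 2 / 2)) (-v) v :=
  ((hasDerivAt_pow 2 v).div_const 2).neg.congr_deriv (by norm_num)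

theorem mills_neg_add (u : ℝ) : mills (-u) + mills u = √(2 * π) * exp (u ^ 2 / 2) := by
  have hd : ∀ v, HasDerivAt (fun v => (mills (-v) + mills v) * exp (-(v ^ 2 / 2))) 0 v := by
    intro v
    have h1 : HasDerivAt (fun v => mills (-v)) ((-v * mills (-v) - 1) * -1) v :=
      (hasDerivAt_mills (-v)).comp v (hasDerivAt_neg v)
    have h2 := hasDerivAt_neg_sq_half v
    exact ((h1.fun_add (hasDerivAt_mills v)).mul h2.exp).congr_deriv (by ring)
  have hc := is_const_of_deriv_eq_zero (fun v => (hd v).differentiableAt)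
    (fun v => (hd v).deriv) u 0
  simp only [neg_zero] at hc
  rw [mills_zero] at hc
  have he : exp (-(u ^ 2 / 2)) * exp (u ^ 2 / 2) = 1 := by rw [← exp_add]; simp
  calc mills (-u) + mills u
      = (mills (-u) + mills u) * exp (-(u ^ 2 / 2)) * exp (u ^ 2 / 2) := by rw [mul_assoc, he]; ring
    _ = _ := by rw [hc]; simp

theorem tendsto_sub_mills_mul_exp {r : ℝ → ℝ} (h0 : Tendsto r atTop (𝓝 0)) :
    Tendsto (fun v => (r v - mills v) * exp (-(v ^ 2 / 2))) atTop (𝓝 0) := by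
  have he : Tendsto (fun v : ℝ => exp (-(v ^ 2 / 2))) atTop (𝓝 0) := by
    simpa using tendsto_pow_mul_exp_linear_sub_sq 0 0
  have hm : Tendsto (fun v : ℝ => mills v * exp (-(v ^ 2 / 2))) atTop (𝓝 0) := by
    refine squeeze_zero' (g := fun v => mills 0 * exp (-(v ^ 2 / 2))) ?_ ?_
      (by simpa using he.const_mul (mills 0))
    · exact Eventually.of_forall fun v => (mul_pos (mills_pos v) (exp_pos _)).le
    · filter_upwards [eventually_ge_atTop 0] with v hv
      have := mills_antitone hv
      gcongr
  simpa [sub_mul] using (h0.mul he).sub hm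

/-- Comparison principle: supersolutions of `r' = u r - 1` vanishing at infinity bound `R`. -/
theorem mills_le_of_hasDerivAt {u₀ : ℝ} {r r' : ℝ → ℝ}
    (hr : ∀ u, u₀ ≤ u → HasDerivAt r (r' u) u) (h0 : Tendsto r atTop (𝓝 0))
    (hle : ∀ u, u₀ ≤ u → r' u ≤ u * r u - 1) {u : ℝ} (hu : u₀ ≤ u) : mills u ≤ r u := by
  have hd : ∀ v, u₀ ≤ v → HasDerivAt (fun v => (r v - mills v) * exp (-(v ^ 2 / 2)))
      ((r' v - (v * r v - 1)) * exp (-(v ^ 2 / 2))) v := fun v hv =>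
    (((hr v hv).fun_sub (hasDerivAt_mills v)).mul (hasDerivAt_neg_sq_half v).exp).congr_deriv
      (by ring)
  have hanti : AntitoneOn (fun v => (r v - mills v) * exp (-(v ^ 2 / 2))) (Ici u₀) := by
    refine antitoneOn_of_deriv_nonpos (convex_Ici u₀)
      (fun v hv => (hd v hv).continuousAt.continuousWithinAt) (fun v hv => ?_) fun v hv => ?_
    · exact (hd v (interior_subset hv)).differentiableAt.differentiableWithinAt
    · rw [(hd v (interior_subset hv)).deriv]
      exact mul_nonpos_of_nonpos_of_nonneg (by linarith [hle v (interior_subset hv)])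
        (exp_pos _).le
  have h' : 0 ≤ (r u - mills u) * exp (-(u ^ 2 / 2)) := by
    refine le_of_tendsto (tendsto_sub_mills_mul_exp h0) ?_
    filter_upwards [eventually_ge_atTop u] with v hv
    exact hanti hu (hu.trans hv) hv
  have := nonneg_of_mul_nonneg_left h' (exp_pos _)
  linarith

theorem le_mills_of_hasDerivAt {u₀ : ℝ} {r r' : ℝ → ℝ}
    (hr : ∀ u, u₀ ≤ u → HasDerivAt r (r' u) u) (h0 : Tendsto r atTop (𝓝 0))
    (hle : ∀ u, u₀ ≤ u → u * r u - 1 ≤ r' u) {u : ℝ} (hu : u₀ ≤ u) : r u ≤ mills u := by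
  have hd : ∀ v, u₀ ≤ v → HasDerivAt (fun v => (r v - mills v) * exp (-(v ^ 2 / 2)))
      ((r' v - (v * r v - 1)) * exp (-(v ^ 2 / 2))) v := fun v hv =>
    (((hr v hv).fun_sub (hasDerivAt_mills v)).mul (hasDerivAt_neg_sq_half v).exp).congr_deriv
      (by ring)
  have hmono : MonotoneOn (fun v => (r v - mills v) * exp (-(v ^ 2 / 2))) (Ici u₀) := by
    refine monotoneOn_of_deriv_nonneg (convex_Ici u₀)
      (fun v hv => (hd v hv).continuousAt.continuousWithinAt) (fun v hv => ?_) fun v hv => ?_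
    · exact (hd v (interior_subset hv)).differentiableAt.differentiableWithinAt
    · rw [(hd v (interior_subset hv)).deriv]
      exact mul_nonneg (by linarith [hle v (interior_subset hv)]) (exp_pos _).le
  have h' : (r u - mills u) * exp (-(u ^ 2 / 2)) ≤ 0 := by
    refine ge_of_tendsto (tendsto_sub_mills_mul_exp h0) ?_
    filter_upwards [eventually_ge_atTop u] with v hv
    exact hmono hu (hu.trans hv) hv
  have := nonpos_of_mul_nonpos_left h' (exp_pos _)
  linarith

theorem tendsto_mills_atTop : Tendsto mills atTop (𝓝 0) := by
  refine squeeze_zero' (Eventually.of_forall fun u => (mills_pos u).le) ?_ tendsto_inv_atTop_zero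
  filter_upwards [eventually_gt_atTop 0] with u hu
  rw [← one_div, le_div_iff₀ hu, mul_comm]
  exact (mul_mills_lt_one u).le

theorem sq_mul_millsMoment_one_mono {s p : ℝ} (hs : 0 < s) (hsp : s ≤ p) :
    s ^ 2 * millsMoment 1 s ≤ p ^ 2 * millsMoment 1 p := by
  have hd : ∀ v, HasDerivAt (fun v => v ^ 2 * millsMoment 1 v) (v * millsMoment 3 v) v := by
    intro v
    refine ((hasDerivAt_pow 2 v).mul (hasDerivAt_millsMoment 1 v)).congr_deriv ?_
    rw [millsMoment_add_two 1 v]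
    push_cast; ring
  have hmono : MonotoneOn (fun v => v ^ 2 * millsMoment 1 v) (Ici 0) := by
    refine monotoneOn_of_deriv_nonneg (convex_Ici 0)
      (fun v _ => (hd v).continuousAt.continuousWithinAt)
      (fun v _ => (hd v).differentiableAt.differentiableWithinAt) fun v hv => ?_
    rw [(hd v).deriv]
    exact mul_nonneg (interior_subset hv : v ∈ Ici (0 : ℝ)) (millsMoment_pos 3 v).le
  exact hmono hs.le (hs.le.trans hsp) hsp

/-- The function `-R'(s)/s`, the slope of `R` in the variable `s²/2`, with its derivative. -/
theorem hasDerivAt_millsMoment_one_div {s : ℝ} (hs : 0 < s) :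
    HasDerivAt (fun v => millsMoment 1 v / v)
      (s * (millsMoment 1 s / s) * (1 - 1 / (s ^ 2 * millsMoment 1 s))) s := by
  have h1 := millsMoment_pos 1 s
  refine ((hasDerivAt_millsMoment 1 s).div (hasDerivAt_id s) hs.ne').congr_deriv ?_
  rw [millsMoment_two, id]
  have h2 := millsMoment_one s
  have h3 : mills s = (1 - millsMoment 1 s) / s := by rw [h2]; field_simp; ring
  rw [h3]
  field_simp
  ring

theorem hasDerivAt_sqrt_sq_add {s y : ℝ} (hs : 0 < s) (hy : 0 < y) :
    HasDerivAt (fun v => √(v ^ 2 + y)) (s / √(s ^ 2 + y)) s := by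
  have h := (((hasDerivAt_pow 2 s).add_const y).sqrt (by positivity))
  refine h.congr_deriv ?_
  field_simp
  norm_num

theorem monotoneOn_slope_ratio {y : ℝ} (hy : 0 < y) :
    MonotoneOn (fun s => (millsMoment 1 √(s ^ 2 + y) / √(s ^ 2 + y)) / (millsMoment 1 s / s))
      (Ioi 0) := by
  have hd : ∀ s ∈ Ioi (0 : ℝ), HasDerivAt
      (fun s => (millsMoment 1 √(s ^ 2 + y) / √(s ^ 2 + y)) / (millsMoment 1 s / s))
      ((millsMoment 1 √(s ^ 2 + y) / √(s ^ 2 + y)) / (millsMoment 1 s / s) * s *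
        (1 / (s ^ 2 * millsMoment 1 s) - 1 / (√(s ^ 2 + y) ^ 2 * millsMoment 1 √(s ^ 2 + y)))) s := by
    intro s hs
    have hs0 : 0 < s := hs
    have hp : 0 < √(s ^ 2 + y) := sqrt_pos.2 (by positivity)
    have h1 := millsMoment_pos 1 s
    have h2 := millsMoment_pos 1 √(s ^ 2 + y)
    have hc := (hasDerivAt_millsMoment_one_div hp).comp s (hasDerivAt_sqrt_sq_add hs0 hy)
    refine (hc.div (hasDerivAt_millsMoment_one_div hs0) (by positivity)).congr_deriv ?_
    simp only [Function.comp]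
    set p := √(s ^ 2 + y)
    field_simp
    ring
  refine monotoneOn_of_deriv_nonneg (convex_Ioi 0)
    (fun v hv => (hd v hv).continuousAt.continuousWithinAt)
    (fun v hv => (hd v (interior_subset hv)).differentiableAt.differentiableWithinAt)
    fun s hs => ?_
  have hs' := interior_subset hs
  have hs0 : 0 < s := hs'
  have hp : 0 < √(s ^ 2 + y) := sqrt_pos.2 (by positivity)
  have h1 := millsMoment_pos 1 s
  have h2 := millsMoment_pos 1 √(s ^ 2 + y)
  rw [(hd s hs').deriv]
  refine mul_nonneg (by positivity) (sub_nonneg.2 ?_)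
  exact one_div_le_one_div_of_le (by positivity)
    (sq_mul_millsMoment_one_mono hs0 (le_sqrt_of_sq_le (by linarith)))

/-- `τ ↦ R(√(τ + y))` is a concave function of `R(√τ)` up to its tangent line:
it lies below the line tangent at `τ = w²`, whose coefficients are nonnegative. -/
theorem exists_tangent_mills_sqrt {w y : ℝ} (hw : 0 < w) (hy : 0 < y) :
    ∃ A B : ℝ, 0 ≤ A ∧ 0 ≤ B ∧ mills √(w ^ 2 + y) = A + B * mills w ∧
      ∀ s, 0 < s → mills √(s ^ 2 + y) ≤ A + B * mills s := by
  set g : ℝ → ℝ := fun s => millsMoment 1 s / s with hg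
  have hgpos : ∀ s, 0 < s → 0 < g s := fun s hs => div_pos (millsMoment_pos 1 s) hs
  have hpos : ∀ s : ℝ, 0 < s → 0 < √(s ^ 2 + y) := fun s hs => sqrt_pos.2 (by positivity)
  set B := g √(w ^ 2 + y) / g w with hB
  have hB0 : 0 ≤ B := (div_pos (hgpos _ (hpos w hw)) (hgpos w hw)).le
  set f : ℝ → ℝ := fun s => B * mills s - mills √(s ^ 2 + y) with hf
  have hd : ∀ s, 0 < s → HasDerivAt f (s * g s * (g √(s ^ 2 + y) / g s - B)) s := by
    intro s hs
    have h := ((hasDerivAt_mills s).const_mul B).fun_sub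
      ((hasDerivAt_mills √(s ^ 2 + y)).comp s (hasDerivAt_sqrt_sq_add hs hy))
    refine h.congr_deriv ?_
    have e1 : s * mills s - 1 = -millsMoment 1 s := by rw [millsMoment_one]; ring
    have e2 : √(s ^ 2 + y) * mills √(s ^ 2 + y) - 1 = -millsMoment 1 √(s ^ 2 + y) := by
      rw [millsMoment_one]; ring
    rw [e1, e2]
    simp only [hg]
    have hp := hpos s hs
    have h1 := millsMoment_pos 1 s
    field_simp
    ring
  have hmin : ∀ s, 0 < s → f w ≤ f s := by
    intro s hs
    rcases le_total w s with h | h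
    · have hmono : MonotoneOn f (Ici w) := by
        refine monotoneOn_of_deriv_nonneg (convex_Ici w)
          (fun v hv => (hd v (hw.trans_le hv)).continuousAt.continuousWithinAt)
          (fun v hv => (hd v (hw.trans_le
            (interior_subset hv))).differentiableAt.differentiableWithinAt) fun v hv => ?_
        have hwv : w ≤ v := interior_subset hv
        have hv0 := hw.trans_le hwv
        rw [(hd v hv0).deriv]
        exact mul_nonneg (mul_pos hv0 (hgpos v hv0)).le
          (sub_nonneg.2 (monotoneOn_slope_ratio hy hw hv0 hwv))
      exact hmono self_mem_Ici h h
    · have hanti : AntitoneOn f (Icc s w) := by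
        refine antitoneOn_of_deriv_nonpos (convex_Icc s w)
          (fun v hv => (hd v (hs.trans_le hv.1)).continuousAt.continuousWithinAt)
          (fun v hv => (hd v (hs.trans_le
            (interior_subset hv).1)).differentiableAt.differentiableWithinAt) fun v hv => ?_
        have hv' := interior_subset hv
        have hv0 := hs.trans_le hv'.1
        rw [(hd v hv0).deriv]
        exact mul_nonpos_of_nonneg_of_nonpos (mul_pos hv0 (hgpos v hv0)).le
          (sub_nonpos.2 (monotoneOn_slope_ratio hy hv0 hw hv'.2))
      exact hanti ⟨le_rfl, h⟩ ⟨h, le_rfl⟩ h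
  refine ⟨-f w, B, ?_, hB0, by simp only [hf]; ring, fun s hs => ?_⟩
  · have hlim : Tendsto f atTop (𝓝 0) := by
      have h2 : Tendsto (fun s : ℝ => √(s ^ 2 + y)) atTop atTop :=
        tendsto_sqrt_atTop.comp (tendsto_atTop_add_const_right _ _
          (tendsto_pow_atTop two_ne_zero))
      simpa [hf] using (tendsto_mills_atTop.const_mul B).sub (tendsto_mills_atTop.comp h2)
    have : f w ≤ 0 := ge_of_tendsto hlim (by
      filter_upwards [eventually_gt_atTop 0] with s hs using hmin s hs)
    linarith
  · have := hmin s hs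
    simp only [hf] at this ⊢
    linarith

theorem integral_Ioi_exp_linear_gaussian {k : ℝ} (hk : 0 < k) (γ : ℝ) :
    ∫ y in Ioi (0 : ℝ), exp (-(γ * y) - y ^ 2 / (2 * k ^ 2)) = k * mills (γ * k) := by
  have h := integral_comp_mul_left_Ioi (fun y => exp (-(γ * y) - y ^ 2 / (2 * k ^ 2))) 0 hk
  rw [mul_zero, smul_eq_mul] at h
  have h2 : mills (γ * k) = ∫ t in Ioi (0 : ℝ), exp (-(γ * (k * t)) - (k * t) ^ 2 / (2 * k ^ 2)) := by
    simp only [mills, millsMoment, pow_zero, one_mul]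
    refine integral_congr_ae (Eventually.of_forall fun t => ?_)
    simp only
    congr 1
    field_simp
  rw [h2, h]
  field_simp

theorem integral_exp_abs_gaussian {k : ℝ} (hk : 0 < k) (γ : ℝ) :
    ∫ y : ℝ, exp (-(γ * |y|) - y ^ 2 / (2 * k ^ 2)) = 2 * k * mills (γ * k) := by
  have h := integral_comp_abs (f := fun y => exp (-(γ * y) - y ^ 2 / (2 * k ^ 2)))
  simp only [sq_abs] at h
  rw [h, integral_Ioi_exp_linear_gaussian hk]
  ring

theorem integrable_exp_neg_sq_div {k : ℝ} (hk : 0 < k) :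
    Integrable (fun y : ℝ => exp (-(y ^ 2 / (2 * k ^ 2)))) := by
  have := integrable_exp_neg_mul_sq (b := 1 / (2 * k ^ 2)) (by positivity)
  refine this.congr (Eventually.of_forall fun y => ?_)
  simp only
  congr 1
  field_simp

theorem integral_Ioi_exp_neg_sq_half : ∫ t in Ioi (0 : ℝ), exp (-(t ^ 2 / 2)) = √(2 * π) / 2 := by
  have h := integral_gaussian_Ioi (1 / 2)
  rw [show π / (1 / 2) = 2 * π by ring] at h
  rw [← h]
  refine integral_congr_ae (Eventually.of_forall fun t => ?_)
  simp only
  congr 1; ring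

/-- The primitive `∫₀ˢ exp(-t²/2) dt`. -/
noncomputable def gaussPrimitive (s : ℝ) : ℝ := ∫ t in (0 : ℝ)..s, exp (-(t ^ 2 / 2))

theorem hasDerivAt_gaussPrimitive (s : ℝ) :
    HasDerivAt gaussPrimitive (exp (-(s ^ 2 / 2))) s := by
  have hc : Continuous fun t : ℝ => exp (-(t ^ 2 / 2)) := by fun_prop
  exact intervalIntegral.integral_hasDerivAt_right (hc.intervalIntegrable _ _)
    (hc.stronglyMeasurableAtFilter _ _) hc.continuousAt

theorem tendsto_gaussPrimitive_atTop : Tendsto gaussPrimitive atTop (𝓝 (√(2 * π) / 2)) := by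
  rw [← integral_Ioi_exp_neg_sq_half]
  refine intervalIntegral_tendsto_integral_Ioi 0 ?_ tendsto_id
  have := integrable_exp_neg_sq_div one_pos
  norm_num at this
  exact this.integrableOn

theorem tendsto_gaussPrimitive_atBot : Tendsto gaussPrimitive atBot (𝓝 (-(√(2 * π) / 2))) := by
  have hneg : ∀ s, gaussPrimitive s = -gaussPrimitive (-s) := by
    intro s
    have h := intervalIntegral.integral_comp_neg (a := 0) (b := s)
      (fun t : ℝ => exp (-(t ^ 2 / 2)))
    simp only [neg_sq, neg_zero] at h
    simp only [gaussPrimitive]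
    rw [h, intervalIntegral.integral_symm]
  have := (tendsto_gaussPrimitive_atTop.comp tendsto_neg_atBot_atTop).neg
  refine this.congr fun s => ?_
  rw [hneg s]; rfl

/-- Subordination: the Laplace kernel `exp(-c|q|)` is a mixture of centred Gaussian kernels. -/
theorem integral_subordination {c q : ℝ} (hc : 0 < c) (hq : 0 < q) :
    ∫ v in Ioi (0 : ℝ), exp (-(c ^ 2 * v ^ 2 / 2) - q ^ 2 / (2 * v ^ 2))
      = √(2 * π) / (2 * c) * exp (-(c * q)) := by
  set G : ℝ → ℝ := fun v => exp (-(c * q)) * gaussPrimitive (c * v - q / v)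
    + exp (c * q) * gaussPrimitive (c * v + q / v) with hG
  set K : ℝ → ℝ := fun v => 2 * c * exp (-(c ^ 2 * v ^ 2 / 2) - q ^ 2 / (2 * v ^ 2)) with hK
  have hd : ∀ v ∈ Ioi (0 : ℝ), HasDerivAt G (K v) v := by
    intro v hv
    have hv0 : v ≠ 0 := (show (0 : ℝ) < v from hv).ne'
    have h1 : HasDerivAt (fun v => c * v - q / v) (c + q / v ^ 2) v := by
      refine (((hasDerivAt_id v).const_mul c).fun_sub
        ((hasDerivAt_const v q).fun_div (hasDerivAt_id v) hv0)).congr_deriv ?_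
      simp; ring
    have h2 : HasDerivAt (fun v => c * v + q / v) (c - q / v ^ 2) v := by
      refine (((hasDerivAt_id v).const_mul c).fun_add
        ((hasDerivAt_const v q).fun_div (hasDerivAt_id v) hv0)).congr_deriv ?_
      simp; ring
    have h3 := (((hasDerivAt_gaussPrimitive _).comp v h1).const_mul (exp (-(c * q)))).fun_add
      (((hasDerivAt_gaussPrimitive _).comp v h2).const_mul (exp (c * q)))
    refine h3.congr_deriv ?_
    have e1 : exp (-(c * q)) * exp (-((c * v - q / v) ^ 2 / 2))
        = exp (-(c ^ 2 * v ^ 2 / 2) - q ^ 2 / (2 * v ^ 2)) := by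
      rw [← exp_add]; congr 1; field_simp; ring
    have e2 : exp (c * q) * exp (-((c * v + q / v) ^ 2 / 2))
        = exp (-(c ^ 2 * v ^ 2 / 2) - q ^ 2 / (2 * v ^ 2)) := by
      rw [← exp_add]; congr 1; field_simp; ring
    rw [← mul_assoc, ← mul_assoc, e1, e2, hK]
    ring
  have hint : IntegrableOn K (Ioi 0) := by
    have h1 : Integrable (fun v : ℝ => 2 * c * exp (-(v ^ 2 / (2 * (1 / c) ^ 2)))) :=
      (integrable_exp_neg_sq_div (by positivity)).const_mul _
    refine h1.integrableOn.mono' (by simp only [hK]; fun_prop) (Eventually.of_forall fun v => ?_)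
    rw [norm_of_nonneg (by simp only [hK]; positivity)]
    simp only [hK]
    gcongr
    have : v ^ 2 / (2 * (1 / c) ^ 2) = c ^ 2 * v ^ 2 / 2 := by field_simp
    rw [this]
    have : 0 ≤ q ^ 2 / (2 * v ^ 2) := by positivity
    linarith
  have hdiv : Tendsto (fun v : ℝ => q / v) (𝓝[>] 0) atTop := by
    simpa [div_eq_mul_inv] using tendsto_inv_nhdsGT_zero.const_mul_atTop hq
  have hdiv' : Tendsto (fun v : ℝ => q / v) atTop (𝓝 0) := tendsto_const_nhds.div_atTop tendsto_id
  have hlin : Tendsto (fun v : ℝ => c * v) (𝓝[>] 0) (𝓝 0) := by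
    have : Tendsto (fun v : ℝ => c * v) (𝓝 0) (𝓝 (c * 0)) := (continuous_const_mul c).tendsto 0
    rw [mul_zero] at this
    exact this.mono_left nhdsWithin_le_nhds
  have hlin' : Tendsto (fun v : ℝ => c * v) atTop atTop := tendsto_id.const_mul_atTop hc
  have l0 : Tendsto G (𝓝[>] 0) (𝓝 (exp (-(c * q)) * -(√(2 * π) / 2)
      + exp (c * q) * (√(2 * π) / 2))) := by
    refine ((tendsto_gaussPrimitive_atBot.comp ?_).const_mul _).add
      ((tendsto_gaussPrimitive_atTop.comp ?_).const_mul _)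
    · simpa [sub_eq_add_neg] using hlin.add_atBot (tendsto_neg_atTop_atBot.comp hdiv)
    · exact hlin.add_atTop hdiv
  have l1 : Tendsto G atTop (𝓝 (exp (-(c * q)) * (√(2 * π) / 2)
      + exp (c * q) * (√(2 * π) / 2))) := by
    refine ((tendsto_gaussPrimitive_atTop.comp ?_).const_mul _).add
      ((tendsto_gaussPrimitive_atTop.comp ?_).const_mul _)
    · simpa [sub_eq_add_neg] using hlin'.atTop_add hdiv'.neg
    · exact hlin'.atTop_add hdiv'
  have h := integral_Ioi_deriv_mul_eq_sub (u := G) (v := fun _ => 1) (u' := K) (v' := fun _ => 0)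
    hd (fun v _ => hasDerivAt_const v 1) ?_ (a' := _) (b' := _)
    (l0.congr fun v => by simp) (l1.congr fun v => by simp)
  · simp only [mul_one, mul_zero, add_zero, hK] at h
    rw [integral_const_mul] at h
    rw [div_mul_eq_mul_div, eq_div_iff (by positivity)]
    linarith
  · refine hint.congr_fun (fun v _ => ?_) measurableSet_Ioi
    simp

/-- A bounded function with nonnegative integral against every centred Gaussian kernel has
nonnegative integral against every product of a Laplace and a centred Gaussian kernel. -/
theorem integral_laplace_gaussian_nonneg {ψ : ℝ → ℝ} {C : ℝ} (hm : Measurable ψ)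
    (hb : ∀ y, |ψ y| ≤ C) (hψ : ∀ k, 0 < k → 0 ≤ ∫ y : ℝ, exp (-(y ^ 2 / (2 * k ^ 2))) * ψ y)
    {c k : ℝ} (hc : 0 < c) (hk : 0 < k) :
    0 ≤ ∫ y : ℝ, exp (-(c * |y|) - y ^ 2 / (2 * k ^ 2)) * ψ y := by
  set f : ℝ → ℝ → ℝ := fun y v =>
    exp (-(c ^ 2 * v ^ 2 / 2) - y ^ 2 / (2 * v ^ 2)) * (exp (-(y ^ 2 / (2 * k ^ 2))) * ψ y) with hf
  have hC : 0 ≤ C := (abs_nonneg _).trans (hb 0)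
  have hmeas : Measurable (Function.uncurry f) := by
    simp only [hf, Function.uncurry_def]
    fun_prop
  have hint : Integrable (Function.uncurry f) (volume.prod (volume.restrict (Ioi (0 : ℝ)))) := by
    have h1 : Integrable (fun v : ℝ => exp (-(v ^ 2 / (2 * (1 / c) ^ 2))))
      (volume.restrict (Ioi 0)) := (integrable_exp_neg_sq_div (by positivity)).restrict
    refine ((((integrable_exp_neg_sq_div hk).mul_prod h1).const_mul C)).mono'
      hmeas.aestronglyMeasurable (Eventually.of_forall fun p => ?_)
    simp only [Function.uncurry, hf]
    rw [norm_mul, norm_mul, norm_of_nonneg (exp_pos _).le, norm_of_nonneg (exp_pos _).le]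
    have e1 : exp (-(c ^ 2 * p.2 ^ 2 / 2) - p.1 ^ 2 / (2 * p.2 ^ 2))
        ≤ exp (-(p.2 ^ 2 / (2 * (1 / c) ^ 2))) := by
      have : p.2 ^ 2 / (2 * (1 / c) ^ 2) = c ^ 2 * p.2 ^ 2 / 2 := by field_simp
      rw [this]
      refine exp_le_exp.2 ?_
      have : 0 ≤ p.1 ^ 2 / (2 * p.2 ^ 2) := by positivity
      linarith
    calc _ ≤ exp (-(p.2 ^ 2 / (2 * (1 / c) ^ 2))) * (exp (-(p.1 ^ 2 / (2 * k ^ 2))) * C) := by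
          have := hb p.1
          gcongr
          exact this
      _ = _ := by ring
  have hsub : ∀ᵐ y : ℝ, exp (-(c * |y|) - y ^ 2 / (2 * k ^ 2)) * ψ y
      = 2 * c / √(2 * π) * ∫ v in Ioi (0 : ℝ), f y v := by
    have h0 : ∀ᵐ y : ℝ, y ≠ 0 := by simp [ae_iff]
    filter_upwards [h0] with y hy
    have h := integral_subordination hc (abs_pos.2 hy)
    simp only [sq_abs] at h
    simp only [hf]
    rw [integral_mul_const, h, sub_eq_add_neg, exp_add]
    have : 0 < √(2 * π) := by positivity
    field_simp
  rw [integral_congr_ae hsub, integral_const_mul, integral_integral_swap hint]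
  refine mul_nonneg (by positivity) (setIntegral_nonneg measurableSet_Ioi fun v hv => ?_)
  have hv0 : (0 : ℝ) < v := hv
  have hk' : 0 < (√(1 / v ^ 2 + 1 / k ^ 2))⁻¹ := by positivity
  have e : ∀ y, f y v = exp (-(c ^ 2 * v ^ 2 / 2)) *
      (exp (-(y ^ 2 / (2 * (√(1 / v ^ 2 + 1 / k ^ 2))⁻¹ ^ 2))) * ψ y) := by
    intro y
    simp only [hf]
    rw [← mul_assoc, ← mul_assoc, ← exp_add, ← exp_add]
    congr 2
    rw [inv_pow, sq_sqrt (by positivity)]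
    field_simp
    ring
  simp only [e]
  rw [integral_const_mul]
  exact mul_nonneg (exp_pos _).le (hψ _ hk')

theorem facc_eq_exp (u : ℝ) : Facc u = exp (u / 2 - |u| / 2) := by
  unfold Facc
  rcases le_total 0 u with h | h
  · rw [abs_of_nonneg h, min_eq_left (one_le_exp h)]
    simp
  · rw [abs_of_nonpos h, min_eq_right (exp_le_one_iff.2 h)]
    congr 1; ring

theorem continuous_facc : Continuous Facc := by
  unfold Facc
  fun_prop

theorem facc_nonneg (u : ℝ) : 0 ≤ Facc u := le_min zero_le_one (exp_pos u).le

theorem facc_le_one (u : ℝ) : Facc u ≤ 1 := min_le_left _ _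

theorem integral_gaussianReal_sq {k : ℝ} (hk : 0 < k) (m : ℝ) (f : ℝ → ℝ) :
    ∫ y, f y ∂gaussianReal m (toNNReal (k ^ 2))
      = (√(2 * π) * k)⁻¹ * ∫ y : ℝ, exp (-((y - m) ^ 2 / (2 * k ^ 2))) * f y := by
  have hk2 : 0 < k ^ 2 := by positivity
  rw [integral_gaussianReal_eq_integral_smul (by simpa using hk2.ne'), ← integral_const_mul]
  refine integral_congr_ae (Eventually.of_forall fun y => ?_)
  simp only [gaussianPDFReal, smul_eq_mul, coe_toNNReal _ hk2.le]
  rw [sqrt_mul (by positivity), sqrt_sq hk.le, neg_div]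
  ring

theorem integral_exp_abs_gaussianReal {s : ℝ} (hs : 0 < s) :
    ∫ y, exp (-(|y| / 2)) ∂gaussianReal 0 (toNNReal ((2 * s) ^ 2)) = mills s / mills 0 := by
  rw [integral_gaussianReal_sq (by positivity)]
  have h := integral_exp_abs_gaussian (k := 2 * s) (by positivity) (1 / 2)
  have e : ∀ y : ℝ, exp (-((y - 0) ^ 2 / (2 * (2 * s) ^ 2))) * exp (-(|y| / 2))
      = exp (-(1 / 2 * |y|) - y ^ 2 / (2 * (2 * s) ^ 2)) := by
    intro y
    rw [← exp_add]; congr 1; ring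
  simp only [e]
  rw [h, mills_zero, show 1 / 2 * (2 * s) = s by ring]
  have : 0 < √(2 * π) := by positivity
  field_simp

/-- The Laplace kernel `exp(-|y|/2)` smoothed by centred Gaussian noise of variance `2σ²`. -/
noncomputable def smoothedLaplace (σ y : ℝ) : ℝ :=
  ∫ w, exp (-(|y + w| / 2)) ∂gaussianReal 0 (toNNReal (2 * σ ^ 2))

theorem measurable_smoothedLaplace (σ : ℝ) : Measurable (smoothedLaplace σ) := by
  unfold smoothedLaplace
  refine (StronglyMeasurable.integral_prod_right' (f := fun p : ℝ × ℝ => exp (-(|p.1 + p.2| / 2)))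
    ?_).measurable
  exact Continuous.stronglyMeasurable (by fun_prop)

theorem smoothedLaplace_nonneg (σ y : ℝ) : 0 ≤ smoothedLaplace σ y :=
  integral_nonneg fun _ => (exp_pos _).le

theorem integrable_exp_abs (ρ : Measure ℝ) [IsFiniteMeasure ρ] (y : ℝ) :
    Integrable (fun w => exp (-(|y + w| / 2))) ρ := by
  refine Integrable.of_bound (C := 1) (by fun_prop) (Eventually.of_forall fun w => ?_)
  rw [norm_of_nonneg (exp_pos _).le, exp_le_one_iff]
  have := abs_nonneg (y + w)
  linarith

theorem smoothedLaplace_le_one (σ y : ℝ) : smoothedLaplace σ y ≤ 1 := by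
  have h : smoothedLaplace σ y ≤ ∫ _, (1 : ℝ) ∂gaussianReal 0 (toNNReal (2 * σ ^ 2)) := by
    refine integral_mono (integrable_exp_abs _ y) (integrable_const _) fun w => ?_
    rw [exp_le_one_iff]
    have := abs_nonneg (y + w)
    linarith
  simpa using h

theorem integral_smoothedLaplace {s σ : ℝ} (hs : 0 < s) (hσ : 0 < σ) :
    ∫ y, smoothedLaplace σ y ∂gaussianReal 0 (toNNReal ((2 * s) ^ 2))
      = mills √(s ^ 2 + σ ^ 2 / 2) / mills 0 := by
  have hc := gaussianReal_conv_gaussianReal (m₁ := 0) (m₂ := 0)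
    (v₁ := toNNReal ((2 * s) ^ 2)) (v₂ := toNNReal (2 * σ ^ 2))
  have h := integral_conv (μ := gaussianReal 0 (toNNReal ((2 * s) ^ 2)))
    (ν := gaussianReal 0 (toNNReal (2 * σ ^ 2))) (f := fun y => exp (-(|y| / 2)))
    (by simpa using integrable_exp_abs _ 0)
  unfold smoothedLaplace
  rw [← h, hc, ← integral_exp_abs_gaussianReal (sqrt_pos.2 (by positivity)), mul_pow 2 √_,
    sq_sqrt (by positivity), ← toNNReal_add (by positivity) (by positivity), add_zero]
  congr 3
  ring

theorem integral_facc_gaussNoise {σ : ℝ} (hσ : 0 < σ) (y : ℝ) :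
    ∫ w, Facc (w + y) ∂gaussNoise σ = exp (y / 2 - σ ^ 2 / 4) * smoothedLaplace σ y := by
  have e2 : 2 * σ ^ 2 = (√2 * σ) ^ 2 := by rw [mul_pow, sq_sqrt (by norm_num)]
  have hk : 0 < √2 * σ := by positivity
  unfold gaussNoise smoothedLaplace
  rw [e2, integral_gaussianReal_sq hk, integral_gaussianReal_sq hk,
    mul_left_comm (exp _), ← integral_const_mul (exp (y / 2 - σ ^ 2 / 4))]
  congr 1
  refine integral_congr_ae (Eventually.of_forall fun w => ?_)
  simp only
  rw [facc_eq_exp, ← exp_add, ← exp_add, ← exp_add, ← e2, add_comm y w]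
  congr 1
  field_simp
  ring

theorem QSmeas_self {μ : ℝ} (β : ℝ) :
    QSmeas μ β β = (gaussianReal (-μ ^ 2 / 2) (toNNReal (μ ^ 2))).map (fun q => (q, -(β * q))) := by
  have h1 : gaussianReal (-μ ^ 2 / 2) (toNNReal (μ ^ 2))
      = ((gaussianReal 0 1).map (fun x => μ * x)).map (fun x => -μ ^ 2 / 2 + x) := by
    rw [gaussianReal_map_const_mul, gaussianReal_map_const_add]
    congr 1
    · simp
    · rw [mul_one]
      ext
      simp [sq_nonneg]
  have h2 : gaussianReal 0 1 = ((gaussianReal 0 1).prod (gaussianReal 0 1)).map Prod.fst := by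
    rw [Measure.map_fst_prod]; simp
  rw [h1, h2, Measure.map_map (by fun_prop) (by fun_prop),
    Measure.map_map (by fun_prop) (by fun_prop), Measure.map_map (by fun_prop) (by fun_prop)]
  unfold QSmeas
  congr 1
  ext z
  · simp
  · simp; ring

instance isProbabilityMeasure_QSmeas (μ β₁ β₂ : ℝ) : IsProbabilityMeasure (QSmeas μ β₁ β₂) :=
  Measure.isProbabilityMeasure_map (by fun_prop)

instance isProbabilityMeasure_gaussNoise (σ : ℝ) : IsProbabilityMeasure (gaussNoise σ) := by
  unfold gaussNoise
  infer_instance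

theorem integral_QSmeas_self {μ : ℝ} (hμ : 0 < μ) (β : ℝ) {f : ℝ × ℝ → ℝ} (hf : Measurable f) :
    ∫ p, f p ∂QSmeas μ β β = exp (-(μ ^ 2 / 8)) * (√(2 * π) * μ)⁻¹ *
      ∫ q : ℝ, exp (-(q / 2) - q ^ 2 / (2 * μ ^ 2)) * f (q, -(β * q)) := by
  rw [QSmeas_self, integral_map (by fun_prop) hf.aestronglyMeasurable, integral_gaussianReal_sq hμ,
    mul_comm (exp _), mul_assoc, ← integral_const_mul (exp _)]
  congr 1
  refine integral_congr_ae (Eventually.of_forall fun q => ?_)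
  simp only
  rw [← mul_assoc, ← exp_add]
  congr 2
  field_simp
  ring

theorem alpha1_self {μ β : ℝ} (hμ : 0 < μ) (hβ : 1 < β) :
    alpha1 μ β β = exp (-(μ ^ 2 / 8)) / √(2 * π)
      * (mills (-(μ / 2)) + mills ((2 * β - 1) * μ / 2)) := by
  have hm : Measurable fun p : ℝ × ℝ => Facc (p.1 + p.2) := by
    have := continuous_facc
    fun_prop
  have habs : ∀ q : ℝ, |q + -(β * q)| = (β - 1) * |q| := by
    intro q
    rw [show q + -(β * q) = -((β - 1) * q) by ring, abs_neg, abs_mul, abs_of_pos (by linarith)]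
  set f : ℝ → ℝ := fun q => exp (-(q / 2) - q ^ 2 / (2 * μ ^ 2)) * Facc (q + -(β * q)) with hf
  have hpos : ∀ q ∈ Ioi (0 : ℝ), f q = exp (-((2 * β - 1) / 2 * q) - q ^ 2 / (2 * μ ^ 2)) := by
    intro q hq
    simp only [hf]
    rw [facc_eq_exp, habs, abs_of_pos hq, ← exp_add]
    congr 1; ring
  have hneg : ∀ q ∈ Ioi (0 : ℝ), f (-q) = exp (-(-(1 / 2) * q) - q ^ 2 / (2 * μ ^ 2)) := by
    intro q hq
    simp only [hf]
    rw [facc_eq_exp, habs, abs_neg, abs_of_pos hq, ← exp_add]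
    congr 1; ring
  have hc : Continuous f := by
    have := continuous_facc
    simp only [hf]
    fun_prop
  have hint : Integrable f := by
    have hbase : Integrable fun q : ℝ => exp (-(q / 2) - q ^ 2 / (2 * μ ^ 2)) := by
      have h1 := (integrable_exp_neg_sq_div (k := √2 * μ) (by positivity)).const_mul
        (exp (μ ^ 2 / 4))
      refine h1.mono' (by fun_prop) (Eventually.of_forall fun q => ?_)
      rw [norm_of_nonneg (exp_pos _).le, ← exp_add, exp_le_exp, mul_pow, sq_sqrt (by norm_num)]
      have : -(q / 2) - q ^ 2 / (2 * μ ^ 2) = μ ^ 2 / 4 + -(q ^ 2 / (2 * (2 * μ ^ 2)))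
          - (q / (2 * μ) + μ / 2) ^ 2 := by
        field_simp; ring
      rw [this]
      linarith [sq_nonneg (q / (2 * μ) + μ / 2)]
    refine hbase.mono' hc.aestronglyMeasurable (Eventually.of_forall fun q => ?_)
    simp only [hf]
    rw [norm_mul, norm_of_nonneg (exp_pos _).le, norm_of_nonneg (facc_nonneg _)]
    exact mul_le_of_le_one_right (exp_pos _).le (facc_le_one _)
  unfold alpha1
  rw [integral_QSmeas_self hμ β hm]
  have hsplit : ∫ q, f q = (∫ q in Iic 0, f q) + ∫ q in Ioi 0, f q :=
    (intervalIntegral.integral_Iic_add_Ioi hint.integrableOn hint.integrableOn).symm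
  have hI : ∫ q in Iic 0, f q = ∫ q in Ioi 0, f (-q) := by
    rw [integral_comp_neg_Ioi, neg_zero]
  change exp (-(μ ^ 2 / 8)) * (√(2 * π) * μ)⁻¹ * ∫ q, f q = _
  rw [hsplit, hI, setIntegral_congr_fun measurableSet_Ioi hneg,
    setIntegral_congr_fun measurableSet_Ioi hpos, integral_Ioi_exp_linear_gaussian hμ,
    integral_Ioi_exp_linear_gaussian hμ, show -(1 / 2) * μ = -(μ / 2) by ring,
    show (2 * β - 1) / 2 * μ = (2 * β - 1) * μ / 2 by ring]
  have : 0 < √(2 * π) := by positivity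
  field_simp

theorem alpha12_self {μ σ β : ℝ} (hμ : 0 < μ) (hσ : 0 < σ) (hβ : 1 < β) :
    alpha12 μ σ β β = exp (-(μ ^ 2 / 8)) * (√(2 * π) * μ)⁻¹ * (exp (-(σ ^ 2 / 4)) *
      ∫ q : ℝ, exp (-((β - 1) / 2 * |q|) - q ^ 2 / (2 * μ ^ 2)) * smoothedLaplace σ (β * q)) := by
  have hF := continuous_facc
  have hmeas : Measurable fun p : (ℝ × ℝ) × ℝ => Facc (p.1.1 + p.1.2) * Facc (p.2 - p.1.2) := by
    fun_prop
  have hint : Integrable (fun p : (ℝ × ℝ) × ℝ => Facc (p.1.1 + p.1.2) * Facc (p.2 - p.1.2))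
      ((QSmeas μ β β).prod (gaussNoise σ)) := by
    refine Integrable.of_bound (C := 1) hmeas.aestronglyMeasurable (Eventually.of_forall fun p => ?_)
    rw [norm_of_nonneg (mul_nonneg (facc_nonneg _) (facc_nonneg _))]
    exact mul_le_one₀ (facc_le_one _) (facc_nonneg _) (facc_le_one _)
  unfold alpha12
  rw [integral_prod _ hint, integral_QSmeas_self hμ β
    (StronglyMeasurable.integral_prod_right' hmeas.stronglyMeasurable).measurable,
    ← integral_const_mul (exp (-(σ ^ 2 / 4)))]
  congr 1
  refine integral_congr_ae (Eventually.of_forall fun q => ?_)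
  simp only
  have habs : |q + -(β * q)| = (β - 1) * |q| := by
    rw [show q + -(β * q) = -((β - 1) * q) by ring, abs_neg, abs_mul, abs_of_pos (by linarith)]
  rw [integral_const_mul]
  simp only [sub_neg_eq_add]
  rw [integral_facc_gaussNoise hσ, facc_eq_exp, habs, ← mul_assoc, ← mul_assoc, ← mul_assoc,
    ← exp_add, ← exp_add, ← exp_add]
  congr 2
  ring

/-- Upper bound for `α₁₂` on the diagonal `β₂ = β₁` from the tangent-line majorant of
`τ ↦ R(√(τ + σ²/2))`. -/
theorem alpha12_self_le {μ σ β A B : ℝ} (hμ : 0 < μ) (hσ : 0 < σ) (hβ : 1 < β)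
    (hAB : ∀ s, 0 < s → mills √(s ^ 2 + σ ^ 2 / 2) ≤ A + B * mills s) :
    alpha12 μ σ β β ≤ exp (-(μ ^ 2 / 8)) * exp (-(σ ^ 2 / 4)) * (2 / √(2 * π)) *
      (A / mills 0 * mills ((β - 1) * μ / 2) + B * mills ((2 * β - 1) * μ / 2)) := by
  have hβ0 : 0 < β := by linarith
  have hM0 := mills_pos 0
  set ψ : ℝ → ℝ := fun y => A / mills 0 + B * exp (-(|y| / 2)) - smoothedLaplace σ y with hψ
  have hexp1 : ∀ y : ℝ, exp (-(|y| / 2)) ≤ 1 := fun y => exp_le_one_iff.2 (by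
    have := abs_nonneg y
    linarith)
  have hmψ : Measurable ψ := by
    have := measurable_smoothedLaplace σ
    simp only [hψ]
    fun_prop
  have hbψ : ∀ y, |ψ y| ≤ |A / mills 0| + |B| + 1 := by
    intro y
    simp only [hψ]
    refine (abs_sub _ _).trans (add_le_add ((abs_add_le _ _).trans (add_le_add le_rfl ?_)) ?_)
    · rw [abs_mul, abs_of_pos (exp_pos _)]
      exact mul_le_of_le_one_right (abs_nonneg _) (hexp1 y)
    · rw [abs_of_nonneg (smoothedLaplace_nonneg _ _)]
      exact smoothedLaplace_le_one _ _
  have hpos : ∀ k, 0 < k → 0 ≤ ∫ y : ℝ, exp (-(y ^ 2 / (2 * k ^ 2))) * ψ y := by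
    intro k hk
    have hk2 : 0 < k / 2 := by positivity
    have e : 2 * (k / 2) = k := by ring
    have h1 := integral_gaussianReal_sq hk 0 ψ
    simp only [sub_zero] at h1
    have i1 : Integrable (fun y : ℝ => exp (-(|y| / 2))) (gaussianReal 0 (toNNReal (k ^ 2))) := by
      simpa using integrable_exp_abs (gaussianReal 0 (toNNReal (k ^ 2))) 0
    have i2 : Integrable (smoothedLaplace σ) (gaussianReal 0 (toNNReal (k ^ 2))) := by
      refine Integrable.of_bound (C := 1) (measurable_smoothedLaplace σ).aestronglyMeasurable
        (Eventually.of_forall fun y => ?_)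
      rw [norm_of_nonneg (smoothedLaplace_nonneg _ _)]
      exact smoothedLaplace_le_one _ _
    have h2 : ∫ y, ψ y ∂gaussianReal 0 (toNNReal (k ^ 2))
        = (A + B * mills (k / 2) - mills √((k / 2) ^ 2 + σ ^ 2 / 2)) / mills 0 := by
      have g1 := integral_exp_abs_gaussianReal hk2
      have g2 := integral_smoothedLaplace hk2 hσ
      rw [e] at g1 g2
      have i3 : Integrable (fun y : ℝ => A / mills 0 + B * exp (-(|y| / 2)))
          (gaussianReal 0 (toNNReal (k ^ 2))) := (integrable_const _).add (i1.const_mul B)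
      simp only [hψ]
      rw [integral_sub i3 i2, integral_add (integrable_const _) (i1.const_mul B),
        integral_const_mul, g1, g2]
      simp
      field_simp
    have h3 : 0 ≤ ∫ y, ψ y ∂gaussianReal 0 (toNNReal (k ^ 2)) := by
      rw [h2]
      exact div_nonneg (sub_nonneg.2 (hAB _ hk2)) hM0.le
    rw [h1] at h3
    exact nonneg_of_mul_nonneg_right h3 (by positivity)
  set k := β * μ with hk
  have hk0 : 0 < k := by positivity
  set c := (β - 1) / (2 * β) with hc
  have hc0 : 0 < c := div_pos (by linarith) (by linarith)
  have hmain := integral_laplace_gaussian_nonneg hmψ hbψ hpos hc0 hk0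
  have hbase : ∀ γ : ℝ, 0 ≤ γ →
      Integrable (fun y : ℝ => exp (-(γ * |y|) - y ^ 2 / (2 * k ^ 2))) := by
    intro γ hγ
    refine (integrable_exp_neg_sq_div hk0).mono' (by fun_prop) (Eventually.of_forall fun y => ?_)
    rw [norm_of_nonneg (exp_pos _).le, exp_le_exp]
    have := mul_nonneg hγ (abs_nonneg y)
    linarith
  have j1 := (hbase c hc0.le).const_mul (A / mills 0)
  have j2 := (hbase (c + 1 / 2) (by positivity)).const_mul B
  have j3 : Integrable (fun y : ℝ => exp (-(c * |y|) - y ^ 2 / (2 * k ^ 2)) * smoothedLaplace σ y) := by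
    refine (hbase c hc0.le).mono' ?_ (Eventually.of_forall fun y => ?_)
    · have := measurable_smoothedLaplace σ
      fun_prop
    · rw [norm_mul, norm_of_nonneg (exp_pos _).le, norm_of_nonneg (smoothedLaplace_nonneg _ _)]
      exact mul_le_of_le_one_right (exp_pos _).le (smoothedLaplace_le_one _ _)
  have j12 : Integrable (fun y : ℝ => A / mills 0 * exp (-(c * |y|) - y ^ 2 / (2 * k ^ 2))
      + B * exp (-((c + 1 / 2) * |y|) - y ^ 2 / (2 * k ^ 2))) := j1.add j2
  have hsplit : ∫ y : ℝ, exp (-(c * |y|) - y ^ 2 / (2 * k ^ 2)) * ψ y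
      = A / mills 0 * (2 * k * mills (c * k)) + B * (2 * k * mills ((c + 1 / 2) * k))
        - ∫ y : ℝ, exp (-(c * |y|) - y ^ 2 / (2 * k ^ 2)) * smoothedLaplace σ y := by
    rw [← integral_exp_abs_gaussian hk0, ← integral_exp_abs_gaussian hk0, ← integral_const_mul,
      ← integral_const_mul, ← integral_add j1 j2, ← integral_sub j12 j3]
    refine integral_congr_ae (Eventually.of_forall fun y => ?_)
    simp only [hψ]
    have : exp (-((c + 1 / 2) * |y|) - y ^ 2 / (2 * k ^ 2))
        = exp (-(c * |y|) - y ^ 2 / (2 * k ^ 2)) * exp (-(|y| / 2)) := by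
      rw [← exp_add]; congr 1; ring
    rw [this]; ring
  have hck : c * k = (β - 1) * μ / 2 := by rw [hc, hk]; field_simp
  have hck2 : (c + 1 / 2) * k = (2 * β - 1) * μ / 2 := by rw [hc, hk]; field_simp; ring
  rw [hsplit, hck, hck2] at hmain
  have hsubst := Measure.integral_comp_mul_left
    (fun y : ℝ => exp (-(c * |y|) - y ^ 2 / (2 * k ^ 2)) * smoothedLaplace σ y) β
  have hq : ∀ q : ℝ, exp (-(c * |β * q|) - (β * q) ^ 2 / (2 * k ^ 2))
      = exp (-((β - 1) / 2 * |q|) - q ^ 2 / (2 * μ ^ 2)) := by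
    intro q
    rw [abs_mul, abs_of_pos hβ0, hc, hk]
    congr 1
    field_simp
  simp only [hq, smul_eq_mul] at hsubst
  rw [alpha12_self hμ hσ hβ, hsubst, abs_of_pos (by positivity)]
  set I := ∫ y : ℝ, exp (-(c * |y|) - y ^ 2 / (2 * k ^ 2)) * smoothedLaplace σ y
  have hs : 0 < √(2 * π) := by positivity
  calc _ = exp (-(μ ^ 2 / 8)) * exp (-(σ ^ 2 / 4)) * ((√(2 * π) * μ)⁻¹ * β⁻¹) * I := by ring
    _ ≤ exp (-(μ ^ 2 / 8)) * exp (-(σ ^ 2 / 4)) * ((√(2 * π) * μ)⁻¹ * β⁻¹) *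
        (A / mills 0 * (2 * k * mills ((β - 1) * μ / 2))
          + B * (2 * k * mills ((2 * β - 1) * μ / 2))) := by
      gcongr
      linarith
    _ = _ := by
      rw [hk]
      field_simp

theorem integral_Ioi_exp_eq_mills (p : ℝ) :
    ∫ x in Ioi p, exp (-(x ^ 2 / 2)) = exp (-(p ^ 2 / 2)) * mills p := by
  have hd : ∀ v, HasDerivAt (fun v => (0 - mills v) * exp (-(v ^ 2 / 2)))
      (exp (-(v ^ 2 / 2))) v := fun v =>
    (((hasDerivAt_const v (0 : ℝ)).fun_sub (hasDerivAt_mills v)).mul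
      (hasDerivAt_neg_sq_half v).exp).congr_deriv (by ring)
  have hi : Integrable fun x : ℝ => exp (-(x ^ 2 / 2)) := by
    simpa using integrable_exp_neg_sq_div one_pos
  have h := integral_Ioi_of_hasDerivAt_of_tendsto' (a := p) (fun v _ => hd v) hi.integrableOn
    (tendsto_sub_mills_mul_exp (r := fun _ => 0) tendsto_const_nhds)
  rw [h]; ring

theorem stdPhi_neg (p : ℝ) : stdPhi (-p) = exp (-(p ^ 2 / 2)) * mills p / √(2 * π) := by
  unfold stdPhi
  rw [gaussianReal_apply_eq_integral 0 one_ne_zero, ENNReal.toReal_ofReal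
    (setIntegral_nonneg measurableSet_Iic fun _ _ => gaussianPDFReal_nonneg _ _ _),
    ← integral_Ioi_exp_eq_mills, ← integral_comp_neg_Ioi, div_eq_inv_mul, ← integral_const_mul]
  refine integral_congr_ae (Eventually.of_forall fun x => ?_)
  simp [gaussianPDFReal, neg_div]

theorem effPM_eq {w σ : ℝ} (hw : 0 < w) :
    EffPM (2 * w) (σ ^ 2) = 8 * w ^ 2 * σ ^ 2 / √(2 * π) * exp (-(w ^ 2 / 2)) *
      exp (-(σ ^ 2 / 4)) * mills √(w ^ 2 + σ ^ 2 / 2) := by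
  have h : √((2 * w) ^ 2 + 2 * σ ^ 2) = 2 * √(w ^ 2 + σ ^ 2 / 2) := by
    rw [show (2 * w) ^ 2 + 2 * σ ^ 2 = 2 ^ 2 * (w ^ 2 + σ ^ 2 / 2) by ring,
      sqrt_mul (by norm_num), sqrt_sq (by norm_num)]
  unfold EffPM
  rw [h, show -(2 * √(w ^ 2 + σ ^ 2 / 2)) / 2 = -√(w ^ 2 + σ ^ 2 / 2) by ring, stdPhi_neg,
    sq_sqrt (by positivity), show -((w ^ 2 + σ ^ 2 / 2) / 2) = -(w ^ 2 / 2) + -(σ ^ 2 / 4) by ring,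
    exp_add]
  ring

theorem bddAbove_effPM :
    BddAbove {y : ℝ | ∃ μ' σ' : ℝ, 0 < μ' ∧ 0 < σ' ∧ y = EffPM μ' (σ' ^ 2)} := by
  refine ⟨32 * mills 0 / √(2 * π), ?_⟩
  rintro _ ⟨μ, σ, hμ, hσ, rfl⟩
  have hw : 0 < μ / 2 := by positivity
  have h := effPM_eq (σ := σ) hw
  rw [show 2 * (μ / 2) = μ by ring] at h
  rw [h]
  set w := μ / 2
  set t := w ^ 2 / 2 + σ ^ 2 / 4 with ht
  have ht0 : 0 < t := by positivity
  have hm : mills √(w ^ 2 + σ ^ 2 / 2) ≤ mills 0 := mills_antitone (sqrt_nonneg _)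
  have hm0 := mills_pos √(w ^ 2 + σ ^ 2 / 2)
  have he : exp (-(w ^ 2 / 2)) * exp (-(σ ^ 2 / 4)) = exp (-t) := by
    rw [← exp_add, ht]; congr 1; ring
  have hbound : w ^ 2 * σ ^ 2 * exp (-t) ≤ 4 := by
    rw [exp_neg, ← div_eq_mul_inv, div_le_iff₀ (exp_pos t)]
    have h1 := quadratic_le_exp_of_nonneg ht0.le
    have h2 : w ^ 2 * σ ^ 2 ≤ 2 * t ^ 2 := by
      rw [ht]; nlinarith [sq_nonneg (w ^ 2 / 2 - σ ^ 2 / 4)]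
    linarith
  have hs : 0 < √(2 * π) := by positivity
  calc _ = 8 / √(2 * π) * (w ^ 2 * σ ^ 2 * exp (-t)) * mills √(w ^ 2 + σ ^ 2 / 2) := by
        rw [← he]; ring
    _ ≤ 8 / √(2 * π) * 4 * mills 0 := by gcongr
    _ = _ := by ring

theorem alpha12_nonneg (μ σ β₁ β₂ : ℝ) : 0 ≤ alpha12 μ σ β₁ β₂ :=
  integral_nonneg fun _ => mul_nonneg (facc_nonneg _) (facc_nonneg _)

theorem alpha1_pos (μ β₁ β₂ : ℝ) : 0 < alpha1 μ β₁ β₂ := by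
  have hF := continuous_facc
  have hpos : ∀ u, 0 < Facc u := fun u => lt_min one_pos (exp_pos u)
  have hint : Integrable (fun p : ℝ × ℝ => Facc (p.1 + p.2)) (QSmeas μ β₁ β₂) := by
    refine Integrable.of_bound (C := 1) (by fun_prop) (Eventually.of_forall fun p => ?_)
    rw [norm_of_nonneg (facc_nonneg _)]
    exact facc_le_one _
  refine (integral_pos_iff_support_of_nonneg (fun _ => facc_nonneg _) hint).2 ?_
  have : Function.support (fun p : ℝ × ℝ => Facc (p.1 + p.2)) = univ :=
    eq_univ_of_forall fun p => (hpos _).ne'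
  rw [this]
  simp

theorem alpha12_div_alpha1_self_le {β u σ w : ℝ} (hβ : 1 < β) (hu : 0 < u) (hσ : 0 < σ)
    (hw : 0 < w)
    (h1 : 2 * u * (β * u) * mills ((β - 1) * u) * exp (w ^ 2 / 2)
      ≤ w ^ 2 * (mills (-u) + mills ((2 * β - 1) * u)))
    (h2 : 2 * mills 0 * u * (β * u) * mills ((2 * β - 1) * u) * exp (w ^ 2 / 2)
      ≤ w ^ 2 * mills w * (mills (-u) + mills ((2 * β - 1) * u))) :
    (2 * u) ^ 2 * σ ^ 2 * (alpha12 (2 * u) σ β β / alpha1 (2 * u) β β)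
      ≤ 1 / β * EffPM (2 * w) (σ ^ 2) := by
  obtain ⟨A, B, hA, hB, hAB, hle⟩ := exists_tangent_mills_sqrt hw (y := σ ^ 2 / 2) (by positivity)
  have hα := alpha12_self_le (mul_pos two_pos hu) hσ hβ hle
  rw [effPM_eq hw, hAB, alpha1_self (mul_pos two_pos hu) hβ]
  rw [show -(2 * u / 2) = -u by ring, show (2 * β - 1) * (2 * u) / 2 = (2 * β - 1) * u by ring]
  rw [show (β - 1) * (2 * u) / 2 = (β - 1) * u by ring,
    show (2 * β - 1) * (2 * u) / 2 = (2 * β - 1) * u by ring] at hα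
  have hβ0 : 0 < β := by linarith
  have hM0 := mills_pos 0
  have hs : √(2 * π) = 2 * mills 0 := by rw [mills_zero]; ring
  rw [hs] at hα ⊢
  have hS : 0 < mills (-u) + mills ((2 * β - 1) * u) := add_pos (mills_pos _) (mills_pos _)
  set S := mills (-u) + mills ((2 * β - 1) * u)
  set R1 := mills ((β - 1) * u)
  set R2 := mills ((2 * β - 1) * u)
  have he : exp (w ^ 2 / 2) * exp (-(w ^ 2 / 2)) = 1 := by rw [← exp_add]; simp
  have h1' : 2 * u * (β * u) * R1 ≤ exp (-(w ^ 2 / 2)) * (w ^ 2 * S) := by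
    calc _ = exp (-(w ^ 2 / 2)) * (2 * u * (β * u) * R1 * exp (w ^ 2 / 2)) := by
          linear_combination (-(2 * u * (β * u) * R1)) * he
      _ ≤ _ := by gcongr
  have h2' : 2 * mills 0 * u * (β * u) * R2 ≤ exp (-(w ^ 2 / 2)) * (w ^ 2 * mills w * S) := by
    calc _ = exp (-(w ^ 2 / 2)) * (2 * mills 0 * u * (β * u) * R2 * exp (w ^ 2 / 2)) := by
          linear_combination (-(2 * mills 0 * u * (β * u) * R2)) * he
      _ ≤ _ := by gcongr
  have key : β * u ^ 2 * (A / mills 0 * R1 + B * R2) * (2 * mills 0)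
      ≤ exp (-(w ^ 2 / 2)) * w ^ 2 * S * (A + B * mills w) := by
    calc _ = A * (2 * u * (β * u) * R1) + B * (2 * mills 0 * u * (β * u) * R2) := by
          field_simp
      _ ≤ A * (exp (-(w ^ 2 / 2)) * (w ^ 2 * S))
          + B * (exp (-(w ^ 2 / 2)) * (w ^ 2 * mills w * S)) := by gcongr
      _ = _ := by ring
  set E1 := exp (-((2 * u) ^ 2 / 8)) with hE1
  have hE1p : 0 < E1 := exp_pos _
  have hE2p : 0 < exp (-(σ ^ 2 / 4)) := exp_pos _
  set E2 := exp (-(σ ^ 2 / 4))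
  have step : alpha12 (2 * u) σ β β / (E1 / (2 * mills 0) * S)
      ≤ 2 * E2 * (A / mills 0 * R1 + B * R2) / S := by
    rw [div_le_div_iff₀ (by positivity) hS]
    calc _ ≤ (E1 * E2 * (2 / (2 * mills 0)) * (A / mills 0 * R1 + B * R2)) * S := by gcongr
      _ = _ := by ring
  calc _ ≤ (2 * u) ^ 2 * σ ^ 2 * (2 * E2 * (A / mills 0 * R1 + B * R2) / S) := by gcongr
    _ = 4 * σ ^ 2 * E2 / (β * S * mills 0) *
        (β * u ^ 2 * (A / mills 0 * R1 + B * R2) * (2 * mills 0)) := by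
      field_simp; ring
    _ ≤ 4 * σ ^ 2 * E2 / (β * S * mills 0) *
        (exp (-(w ^ 2 / 2)) * w ^ 2 * S * (A + B * mills w)) := by gcongr
    _ = _ := by field_simp; ring

theorem tendsto_quadratic_div_cubic_atTop {p q b c d : ℝ} (hp : 0 < p) (hq : 0 < q) (hb : 0 < b)
    (hc : 0 < c) (hd : 0 < d) :
    Tendsto (fun u : ℝ => (u ^ 2 + p * u + q) / (u ^ 3 + b * u ^ 2 + c * u + d)) atTop (𝓝 0) := by
  have hlim : Tendsto (fun u : ℝ => (1 + p + q) * u⁻¹) atTop (𝓝 0) := by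
    simpa using tendsto_inv_atTop_zero.const_mul (1 + p + q)
  refine tendsto_of_tendsto_of_tendsto_of_le_of_le' tendsto_const_nhds hlim ?_ ?_
  · filter_upwards [eventually_ge_atTop 1] with u hu
    positivity
  · filter_upwards [eventually_ge_atTop 1] with u hu
    have hu0 : 0 < u := by linarith
    rw [div_le_iff₀ (by positivity)]
    calc u ^ 2 + p * u + q ≤ u ^ 2 + p * u ^ 2 + q * u ^ 2 := by
          gcongr
          · nlinarith
          · exact le_mul_of_one_le_right hq.le (one_le_pow₀ hu)
      _ = (1 + p + q) * u⁻¹ * u ^ 3 := by field_simp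
      _ ≤ _ := by
          gcongr
          nlinarith [mul_pos hb (pow_pos hu0 2), mul_pos hc hu0]

theorem hasDerivAt_quadratic_div_cubic {p q b c d u : ℝ}
    (hD : 0 < u ^ 3 + b * u ^ 2 + c * u + d) :
    HasDerivAt (fun u : ℝ => (u ^ 2 + p * u + q) / (u ^ 3 + b * u ^ 2 + c * u + d))
      (((2 * u + p) * (u ^ 3 + b * u ^ 2 + c * u + d)
        - (u ^ 2 + p * u + q) * (3 * u ^ 2 + 2 * b * u + c))
        / (u ^ 3 + b * u ^ 2 + c * u + d) ^ 2) u := by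
  have h1 : HasDerivAt (fun u : ℝ => u ^ 2 + p * u + q) (2 * u + p) u :=
    ((((hasDerivAt_id u).pow 2).fun_add ((hasDerivAt_id u).const_mul p)).add_const q).congr_deriv
      (by simp)
  have h2 : HasDerivAt (fun u : ℝ => u ^ 3 + b * u ^ 2 + c * u + d)
      (3 * u ^ 2 + 2 * b * u + c) u :=
    (((((hasDerivAt_id u).pow 3).fun_add (((hasDerivAt_id u).pow 2).const_mul b)).fun_add
      ((hasDerivAt_id u).const_mul c)).add_const d).congr_deriv (by simp; ring)
  exact h1.fun_div h2 hD.ne'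

theorem mills_le_quadratic_div_cubic {p q b c d u₀ u : ℝ} (hu₀ : 0 ≤ u₀) (hp : 0 < p) (hq : 0 < q)
    (hb : 0 < b) (hc : 0 < c) (hd : 0 < d)
    (h : ∀ u, u₀ ≤ u → 0 ≤ (u * (u ^ 2 + p * u + q) - (u ^ 3 + b * u ^ 2 + c * u + d))
      * (u ^ 3 + b * u ^ 2 + c * u + d) - ((2 * u + p) * (u ^ 3 + b * u ^ 2 + c * u + d)
        - (u ^ 2 + p * u + q) * (3 * u ^ 2 + 2 * b * u + c))) (hu : u₀ ≤ u) :
    mills u ≤ (u ^ 2 + p * u + q) / (u ^ 3 + b * u ^ 2 + c * u + d) := by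
  refine mills_le_of_hasDerivAt (r := fun u => (u ^ 2 + p * u + q) / (u ^ 3 + b * u ^ 2 + c * u + d))
    (fun v hv => hasDerivAt_quadratic_div_cubic ?_)
    (tendsto_quadratic_div_cubic_atTop hp hq hb hc hd) (fun v hv => ?_) hu
  · have : 0 ≤ v := hu₀.trans hv
    positivity
  · have hv0 : 0 ≤ v := hu₀.trans hv
    have hD : 0 < v ^ 3 + b * v ^ 2 + c * v + d := by positivity
    rw [div_le_iff₀ (by positivity)]
    have := h v hv
    set D := v ^ 3 + b * v ^ 2 + c * v + d
    have e : (v * ((v ^ 2 + p * v + q) / D) - 1) * D ^ 2 = (v * (v ^ 2 + p * v + q) - D) * D := by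
      field_simp
    linarith

theorem quadratic_div_cubic_le_mills {p q b c d u₀ u : ℝ} (hu₀ : 0 ≤ u₀) (hp : 0 < p) (hq : 0 < q)
    (hb : 0 < b) (hc : 0 < c) (hd : 0 < d)
    (h : ∀ u, u₀ ≤ u → (u * (u ^ 2 + p * u + q) - (u ^ 3 + b * u ^ 2 + c * u + d))
      * (u ^ 3 + b * u ^ 2 + c * u + d) - ((2 * u + p) * (u ^ 3 + b * u ^ 2 + c * u + d)
        - (u ^ 2 + p * u + q) * (3 * u ^ 2 + 2 * b * u + c)) ≤ 0) (hu : u₀ ≤ u) :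
    (u ^ 2 + p * u + q) / (u ^ 3 + b * u ^ 2 + c * u + d) ≤ mills u := by
  refine le_mills_of_hasDerivAt (r := fun u => (u ^ 2 + p * u + q) / (u ^ 3 + b * u ^ 2 + c * u + d))
    (fun v hv => hasDerivAt_quadratic_div_cubic ?_)
    (tendsto_quadratic_div_cubic_atTop hp hq hb hc hd) (fun v hv => ?_) hu
  · have : 0 ≤ v := hu₀.trans hv
    positivity
  · have hv0 : 0 ≤ v := hu₀.trans hv
    have hD : 0 < v ^ 3 + b * v ^ 2 + c * v + d := by positivity
    rw [le_div_iff₀ (by positivity)]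
    have := h v hv
    set D := v ^ 3 + b * v ^ 2 + c * v + d
    have e : (v * ((v ^ 2 + p * v + q) / D) - 1) * D ^ 2 = (v * (v ^ 2 + p * v + q) - D) * D := by
      field_simp
    linarith

theorem mul_mills_le_of_nonneg {u : ℝ} (hu : 0 ≤ u) :
    (u ^ 3 + 4.091 * u ^ 2 + 7.462 * u + 5.254) * mills u ≤ u ^ 2 + 4.091 * u + 6.587 := by
  rw [← le_div_iff₀' (by positivity)]
  refine mills_le_quadratic_div_cubic le_rfl (by norm_num) (by norm_num) (by norm_num)
    (by norm_num) (by norm_num) (fun v hv => ?_) hu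
  nlinarith [sq_nonneg (v ^ 2 - 2.6065 * v + 0.650746), sq_nonneg v]

theorem le_mul_mills_of_nonneg {u : ℝ} (hu : 0 ≤ u) :
    u ^ 2 + 4.614 * u + 8.401 ≤ (u ^ 3 + 4.642 * u ^ 2 + 9.031 * u + 6.704) * mills u := by
  rw [← div_le_iff₀' (by positivity)]
  refine quadratic_div_cubic_le_mills le_rfl (by norm_num) (by norm_num) (by norm_num)
    (by norm_num) (by norm_num) (fun v hv => ?_) hu
  nlinarith [mul_nonneg hv (sq_nonneg (v ^ 2 - 4.286143 * v + 2.48106)), sq_nonneg v,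
    mul_nonneg hv (sq_nonneg v), pow_nonneg hv 4]

theorem mul_mills_le_of_one_le {u : ℝ} (hu : 1 ≤ u) :
    (u ^ 3 + 3.5608 * u ^ 2 + 6.364 * u + 4.3183) * mills u ≤ u ^ 2 + 3.5608 * u + 5.4339 := by
  have hu0 : 0 ≤ u := by linarith
  rw [← le_div_iff₀' (by positivity)]
  refine mills_le_quadratic_div_cubic zero_le_one (by norm_num) (by norm_num) (by norm_num)
    (by norm_num) (by norm_num) (fun v hv => ?_) hu
  have hv' : 0 ≤ v - 1 := sub_nonneg.2 hv
  nlinarith [sq_nonneg ((v - 1) ^ 2 - 1.638055 * (v - 1) + 0.195135), sq_nonneg (v - 1),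
    pow_nonneg hv' 3]

theorem le_mul_mills_of_one_le {u : ℝ} (hu : 1 ≤ u) :
    u ^ 2 + 4.151 * u + 7.1438 ≤ (u ^ 3 + 4.1698 * u ^ 2 + 7.8885 * u + 5.693) * mills u := by
  have hu0 : 0 ≤ u := by linarith
  rw [← div_le_iff₀' (by positivity)]
  refine quadratic_div_cubic_le_mills zero_le_one (by norm_num) (by norm_num) (by norm_num)
    (by norm_num) (by norm_num) (fun v hv => ?_) hu
  have hv' : 0 ≤ v - 1 := sub_nonneg.2 hv
  nlinarith [mul_nonneg hv' (sq_nonneg ((v - 1) ^ 2 - 2.204994 * (v - 1) + 0.891416)),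
    sq_nonneg (v - 1), pow_nonneg hv' 3, pow_nonneg hv' 4]

theorem neg_one_pow_mul_exp_neg_sub_sum_nonneg (n : ℕ) {x : ℝ} (hx : 0 ≤ x) :
    0 ≤ (-1) ^ n * (exp (-x) - ∑ j ∈ Finset.range n, (-x) ^ j / j.factorial) := by
  induction n generalizing x with
  | zero => simpa using (exp_pos _).le
  | succ n ih =>
    have hd : ∀ y : ℝ, HasDerivAt
        (fun y => (-1) ^ (n + 1) * (exp (-y) - ∑ j ∈ Finset.range (n + 1), (-y) ^ j / j.factorial))
        ((-1) ^ n * (exp (-y) - ∑ j ∈ Finset.range n, (-y) ^ j / j.factorial)) y := by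
      intro y
      have hs : HasDerivAt (fun y : ℝ => ∑ j ∈ Finset.range (n + 1), (-y) ^ j / j.factorial)
          (-∑ j ∈ Finset.range n, (-y) ^ j / j.factorial) y := by
        simp_rw [Finset.sum_range_succ' _ n, pow_zero]
        refine ((HasDerivAt.fun_sum fun j _ =>
          (((hasDerivAt_neg y).fun_pow (j + 1)).div_const ((j + 1).factorial : ℝ))).add_const
            _).congr_deriv ?_
        rw [← Finset.sum_neg_distrib]
        refine Finset.sum_congr rfl fun j _ => ?_
        rw [Nat.factorial_succ]
        push_cast
        have : (j.factorial : ℝ) ≠ 0 := by positivity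
        field_simp
      have he : HasDerivAt (fun y : ℝ => exp (-y)) (-exp (-y)) y := by
        simpa using (hasDerivAt_neg y).exp
      exact ((he.fun_sub hs).const_mul _).congr_deriv (by ring)
    have hm : MonotoneOn
        (fun y => (-1) ^ (n + 1) * (exp (-y) - ∑ j ∈ Finset.range (n + 1), (-y) ^ j / j.factorial))
        (Ici (0 : ℝ)) := by
      refine monotoneOn_of_deriv_nonneg (convex_Ici 0)
        (fun y _ => (hd y).continuousAt.continuousWithinAt)
        (fun y _ => (hd y).differentiableAt.differentiableWithinAt) fun y hy => ?_
      rw [(hd y).deriv]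
      exact ih (by simpa using (interior_subset hy : y ∈ Ici (0 : ℝ)))
    have := hm self_mem_Ici hx hx
    simpa [Finset.sum_range_succ'] using this

theorem integrableOn_pow_div_factorial_mul_exp (j : ℕ) (u x : ℝ) :
    IntegrableOn (fun t : ℝ => (x * t) ^ j / j.factorial * exp (-(u * t) - t ^ 2 / 2)) (Ioi 0) := by
  have h : IntegrableOn (fun t : ℝ => x ^ j / j.factorial
      * (t ^ j * exp (-(u * t) - t ^ 2 / 2))) (Ioi 0) :=
    (integrableOn_millsMoment j u).const_mul _
  refine h.congr_fun (fun t _ => ?_) measurableSet_Ioi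
  simp only [mul_pow]
  ring

theorem sum_mul_millsMoment_eq (n : ℕ) (u x : ℝ) :
    ∑ j ∈ Finset.range n, x ^ j / j.factorial * millsMoment j u
      = ∫ t in Ioi (0 : ℝ), (∑ j ∈ Finset.range n, (x * t) ^ j / j.factorial)
          * exp (-(u * t) - t ^ 2 / 2) := by
  simp_rw [Finset.sum_mul]
  rw [integral_finsetSum]
  · refine Finset.sum_congr rfl fun j _ => ?_
    rw [millsMoment, ← integral_const_mul (x ^ j / j.factorial)]
    congr 1 with t
    rw [mul_pow]
    ring
  · intro j _
    exact integrableOn_pow_div_factorial_mul_exp j u x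

theorem integrableOn_sum_mul_exp (n : ℕ) (u x : ℝ) :
    IntegrableOn (fun t : ℝ => (∑ j ∈ Finset.range n, (x * t) ^ j / j.factorial)
          * exp (-(u * t) - t ^ 2 / 2)) (Ioi 0) := by
  simp_rw [Finset.sum_mul]
  refine integrable_finsetSum _ fun j _ => ?_
  exact integrableOn_pow_div_factorial_mul_exp j u x

theorem mills_eq_integral (u : ℝ) :
    mills u = ∫ t in Ioi (0 : ℝ), exp (-(u * t) - t ^ 2 / 2) := by
  simp [mills, millsMoment]

theorem integrableOn_mills (u : ℝ) :
    IntegrableOn (fun t : ℝ => exp (-(u * t) - t ^ 2 / 2)) (Ioi 0) := by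
  simpa using integrableOn_millsMoment 0 u

/-- Taylor expansions of the Mills ratio at `u` are alternately lower and upper bounds. -/
theorem neg_one_pow_mul_mills_add_sub_sum_nonneg (n : ℕ) (u : ℝ) {a : ℝ} (ha : 0 ≤ a) :
    0 ≤ (-1) ^ n * (mills (u + a)
      - ∑ j ∈ Finset.range n, (-a) ^ j / j.factorial * millsMoment j u) := by
  rw [sum_mul_millsMoment_eq, mills_eq_integral,
    ← integral_sub (integrableOn_mills _) (integrableOn_sum_mul_exp n u (-a)),
    ← integral_const_mul ((-1) ^ n)]
  refine setIntegral_nonneg measurableSet_Ioi fun t ht => ?_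
  have h := neg_one_pow_mul_exp_neg_sub_sum_nonneg n (mul_nonneg ha (le_of_lt ht))
  rw [show -((u + a) * t) - t ^ 2 / 2 = -(a * t) + (-(u * t) - t ^ 2 / 2) by ring, exp_add,
    ← sub_mul, ← mul_assoc, neg_mul]
  exact mul_nonneg h (exp_pos _).le

theorem sum_mul_millsMoment_le_mills_sub (n : ℕ) (u : ℝ) {x : ℝ} (hx : 0 ≤ x) :
    ∑ j ∈ Finset.range n, x ^ j / j.factorial * millsMoment j u ≤ mills (u - x) := by
  rw [sum_mul_millsMoment_eq, mills_eq_integral]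
  refine setIntegral_mono_on (integrableOn_sum_mul_exp n u x) (integrableOn_mills _)
    measurableSet_Ioi fun t ht => ?_
  rw [show -((u - x) * t) - t ^ 2 / 2 = x * t + (-(u * t) - t ^ 2 / 2) by ring, exp_add]
  gcongr
  exact Real.sum_le_exp_of_nonneg (mul_nonneg hx (le_of_lt ht)) n

/-- The binary form `∑ cᵢ xⁱ yⁿ⁻ⁱ` of degree `n` whose `n + 1` coefficients are listed in `l`. -/
def bernsteinForm (x y : ℝ) : List ℕ → ℝ
  | [] => 0
  | c :: l => c * y ^ l.length + x * bernsteinForm x y l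

/-- The form in `x, y` whose coefficients are the forms in `z, w` given by the rows of `l`. -/
def bernsteinForm₂ (x y z w : ℝ) : List (List ℕ) → ℝ
  | [] => 0
  | c :: l => bernsteinForm z w c * y ^ l.length + x * bernsteinForm₂ x y z w l

lemma bernsteinForm_nonneg {x y : ℝ} (hx : 0 ≤ x) (hy : 0 ≤ y) (l : List ℕ) :
    0 ≤ bernsteinForm x y l := by
  induction l with
  | nil => exact le_rfl
  | cons c l ih => simp only [bernsteinForm]; positivity

lemma bernsteinForm₂_nonneg {x y z w : ℝ} (hx : 0 ≤ x) (hy : 0 ≤ y) (hz : 0 ≤ z) (hw : 0 ≤ w)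
    (l : List (List ℕ)) : 0 ≤ bernsteinForm₂ x y z w l := by
  induction l with
  | nil => exact le_rfl
  | cons c l ih =>
    have := bernsteinForm_nonneg hz hw c
    simp only [bernsteinForm₂]
    positivity

lemma mills_zero_bounds : 1.253314 ≤ mills 0 ∧ mills 0 ≤ 1.253315 := by
  have h1 := pi_gt_d6
  have h2 := pi_lt_d6
  rw [mills_zero]
  have h3 : 2.506628 ≤ √(2 * π) := le_sqrt_of_sq_le (by norm_num; linarith)
  have h4 : √(2 * π) ≤ 2.50663 := sqrt_le_iff.2 ⟨by norm_num, by norm_num; linarith⟩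
  constructor <;> linarith

lemma mills_neg_eq (u : ℝ) : mills (-u) = 2 * mills 0 * exp (u ^ 2 / 2) - mills u := by
  have := mills_neg_add u
  rw [mills_zero]
  linarith

lemma millsMoment_zero_right :
    millsMoment 1 0 = 1 ∧ millsMoment 2 0 = mills 0 ∧ millsMoment 3 0 = 2 ∧
      millsMoment 4 0 = 3 * mills 0 ∧ millsMoment 5 0 = 8 ∧ millsMoment 6 0 = 15 * mills 0 ∧
      millsMoment 7 0 = 48 ∧ millsMoment 8 0 = 105 * mills 0 ∧ millsMoment 9 0 = 384 := by
  have h1 : millsMoment 1 0 = 1 := by rw [millsMoment_one]; ring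
  have h2 := millsMoment_add_two 0 0
  have h3 := millsMoment_add_two 1 0
  have h4 := millsMoment_add_two 2 0
  have h5 := millsMoment_add_two 3 0
  have h6 := millsMoment_add_two 4 0
  have h7 := millsMoment_add_two 5 0
  have h8 := millsMoment_add_two 6 0
  have h9 := millsMoment_add_two 7 0
  norm_num at h2 h3 h4 h5 h6 h7 h8 h9
  refine ⟨h1, h2, ?_, ?_, ?_, ?_, ?_, ?_, ?_⟩
  · rw [h3, h1]; norm_num
  · rw [h4, h2, mills]
  · rw [h5, h3, h1]; norm_num
  · rw [h6, h4, h2, mills]; ring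
  · rw [h7, h5, h3, h1]; norm_num
  · rw [h8, h6, h4, h2, mills]; ring
  · rw [h9, h7, h5, h3, h1]; norm_num

lemma mul_add_le_of_mul_le {α β N D R p : ℝ} (hD : 0 < D) (hR : α * (D * R) ≤ α * N)
    (h : 0 ≤ p * D - (α * N + β * D)) : α * R + β ≤ p := by
  refine le_of_mul_le_mul_left ?_ hD
  linarith

lemma le_mul_add_of_le_mul {α β N D R p : ℝ} (hD : 0 < D) (hR : α * N ≤ α * (D * R))
    (h : 0 ≤ α * N + β * D - p * D) : p ≤ α * R + β := by
  refine le_of_mul_le_mul_left ?_ hD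
  linarith

lemma mul_le_add_of_rational_bounds {k q x y N D N' D' : ℝ} (hk : 0 ≤ k) (hD : 0 < D)
    (hD' : 0 < D') (hx : D * x ≤ N) (hy : N' ≤ D' * y)
    (h : 0 ≤ q * D' * D + N' * D - k * N * D') : k * x ≤ q + y := by
  refine le_of_mul_le_mul_left ?_ (mul_pos hD hD')
  have h1 := mul_le_mul_of_nonneg_left hx (mul_nonneg hk hD'.le)
  have h2 := mul_le_mul_of_nonneg_left hy hD.le
  linarith

lemma mul_le_of_rational_bound {k q y N D : ℝ} (hq : 0 ≤ q) (hy : 0 ≤ y) (hD : 0 < D)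
    (hyN : D * y ≤ N) (h : 0 ≤ q * D - k * N) : k * y ≤ q := by
  rcases le_total k 0 with hk | hk
  · exact (mul_nonpos_of_nonpos_of_nonneg hk hy).trans hq
  · refine le_of_mul_le_mul_left ?_ hD
    have := mul_le_mul_of_nonneg_left hyN hk
    linarith

/-- The two inequalities on a scale `w` that transfer the bound on the acceptance probability
at `(u, u + a)` to the pseudo-marginal one at `w`. -/
def IsComparisonScale (u a w : ℝ) : Prop :=
  0 < w ∧
    2 * u * (u + a) * mills a * exp (w ^ 2 / 2) ≤ w ^ 2 * (mills (-u) + mills (u + 2 * a)) ∧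
    2 * mills 0 * u * (u + a) * mills (u + 2 * a) * exp (w ^ 2 / 2)
      ≤ w ^ 2 * mills w * (mills (-u) + mills (u + 2 * a))

lemma isComparisonScale_of_le {u a w q K K₂ : ℝ} (hu : 0 ≤ u) (ha : 0 ≤ a) (hw : 0 < w)
    (hK : exp (w ^ 2 / 2) ≤ K * w ^ 2) (hK₂ : 2 * mills 0 * K ≤ K₂ * mills w)
    (hq : q ≤ mills (-u)) (h1 : 2 * K * (u * (u + a)) * mills a ≤ q + mills (u + 2 * a))
    (h2 : (K₂ * (u * (u + a)) - 1) * mills (u + 2 * a) ≤ q) : IsComparisonScale u a w := by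
  have hRa := (mills_pos a).le
  have hRz := (mills_pos (u + 2 * a)).le
  have hRw := (mills_pos w).le
  have hR0 := (mills_pos 0).le
  refine ⟨hw, ?_, ?_⟩
  · calc 2 * u * (u + a) * mills a * exp (w ^ 2 / 2)
        ≤ 2 * u * (u + a) * mills a * (K * w ^ 2) := by gcongr
      _ = w ^ 2 * (2 * K * (u * (u + a)) * mills a) := by ring
      _ ≤ w ^ 2 * (mills (-u) + mills (u + 2 * a)) := by gcongr; linarith
  · calc 2 * mills 0 * u * (u + a) * mills (u + 2 * a) * exp (w ^ 2 / 2)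
        ≤ 2 * mills 0 * u * (u + a) * mills (u + 2 * a) * (K * w ^ 2) := by gcongr
      _ = w ^ 2 * (u * (u + a) * mills (u + 2 * a)) * (2 * mills 0 * K) := by ring
      _ ≤ w ^ 2 * (u * (u + a) * mills (u + 2 * a)) * (K₂ * mills w) := by gcongr
      _ = w ^ 2 * mills w * (K₂ * (u * (u + a)) * mills (u + 2 * a)) := by ring
      _ ≤ w ^ 2 * mills w * (mills (-u) + mills (u + 2 * a)) := by gcongr; linarith

/-- Constant scales in terms of the rational bounds for the Mills ratio on `[0, ∞)`. -/
lemma isComparisonScale_of_rational_bounds {u a w q K K₂ : ℝ} (hu : 0 ≤ u) (ha : 0 ≤ a)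
    (hw : 0 < w) (hK0 : 0 ≤ K) (hK : exp (w ^ 2 / 2) ≤ K * w ^ 2)
    (hK₂ : 2 * mills 0 * K ≤ K₂ * mills w) (hq0 : 0 ≤ q) (hq : q ≤ mills (-u))
    (h1 : 0 ≤ q * ((u + 2 * a) ^ 3 + 4.642 * (u + 2 * a) ^ 2 + 9.031 * (u + 2 * a) + 6.704) *
        (a ^ 3 + 4.091 * a ^ 2 + 7.462 * a + 5.254) +
      ((u + 2 * a) ^ 2 + 4.614 * (u + 2 * a) + 8.401) *
        (a ^ 3 + 4.091 * a ^ 2 + 7.462 * a + 5.254) -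
      2 * K * (u * (u + a)) * (a ^ 2 + 4.091 * a + 6.587) *
        ((u + 2 * a) ^ 3 + 4.642 * (u + 2 * a) ^ 2 + 9.031 * (u + 2 * a) + 6.704))
    (h2 : 0 ≤ q * ((u + 2 * a) ^ 3 + 4.091 * (u + 2 * a) ^ 2 + 7.462 * (u + 2 * a) + 5.254) -
      (K₂ * (u * (u + a)) - 1) * ((u + 2 * a) ^ 2 + 4.091 * (u + 2 * a) + 6.587)) :
    IsComparisonScale u a w :=
  isComparisonScale_of_le hu ha hw hK hK₂ hq
    (mul_le_add_of_rational_bounds (by positivity) (by positivity) (by positivity)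
      (mul_mills_le_of_nonneg ha) (le_mul_mills_of_nonneg (by positivity)) h1)
    (mul_le_of_rational_bound hq0 (mills_pos _).le (by positivity)
      (mul_mills_le_of_nonneg (by positivity)) h2)

lemma mills_sub_mills_add_le {u a k₁ k₂ k₃ k₄ k₅ : ℝ} (ha : 0 ≤ a) (h1 : millsMoment 1 u ≤ k₁)
    (h2 : k₂ ≤ millsMoment 2 u) (h3 : millsMoment 3 u ≤ k₃) (h4 : k₄ ≤ millsMoment 4 u)
    (h5 : millsMoment 5 u ≤ k₅) :
    mills u - mills (u + 2 * a) ≤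
      2 * a * k₁ - 2 * a ^ 2 * k₂ + 4 / 3 * a ^ 3 * k₃ - 2 / 3 * a ^ 4 * k₄ +
        4 / 15 * a ^ 5 * k₅ := by
  have h := neg_one_pow_mul_mills_add_sub_sum_nonneg 6 u (by positivity : 0 ≤ 2 * a)
  have e0 : millsMoment 0 u = mills u := rfl
  simp only [Finset.sum_range_succ, Finset.sum_range_zero, Nat.factorial, e0] at h
  norm_num at h
  have e1 := mul_le_mul_of_nonneg_left h1 (by positivity : 0 ≤ 2 * a)
  have e2 := mul_le_mul_of_nonneg_left h2 (by positivity : 0 ≤ 2 * a ^ 2)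
  have e3 := mul_le_mul_of_nonneg_left h3 (by positivity : 0 ≤ 4 / 3 * a ^ 3)
  have e4 := mul_le_mul_of_nonneg_left h4 (by positivity : 0 ≤ 2 / 3 * a ^ 4)
  have e5 := mul_le_mul_of_nonneg_left h5 (by positivity : 0 ≤ 4 / 15 * a ^ 5)
  ring_nf at h e1 e2 e3 e4 e5 ⊢
  linarith

/-- Third- and fourth-order Taylor expansions at `s` compare `mills (s - x)` with
`mills (s + a)`. -/
lemma mills_add_le_mul_mills_sub {s a x r f₀ f₁ f₂ f₃ f₄ : ℝ} (ha : 0 ≤ a) (hx : 0 ≤ x)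
    (hxa : x ≤ a) (hr0 : 0 ≤ r) (hr1 : r ≤ 1) (h0 : mills s ≤ f₀) (h1 : f₁ ≤ millsMoment 1 s)
    (h2 : millsMoment 2 s ≤ f₂) (h3 : f₃ ≤ millsMoment 3 s) (h4 : millsMoment 4 s ≤ f₄)
    (h : 0 ≤ r * (f₀ + x * f₁ + x ^ 2 / 2 * f₂ + x ^ 3 / 6 * f₃) -
      (f₀ - a * f₁ + a ^ 2 / 2 * f₂ - a ^ 3 / 6 * f₃ + a ^ 4 / 24 * f₄)) :
    mills (s + a) ≤ r * mills (s - x) := by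
  have hz := neg_one_pow_mul_mills_add_sub_sum_nonneg 5 s ha
  have hw := sum_mul_millsMoment_le_mills_sub 4 s hx
  have hs : millsMoment 0 s = mills s := rfl
  simp only [Finset.sum_range_succ, Finset.sum_range_zero, Nat.factorial, hs] at hz hw
  norm_num at hz hw
  have hrx : r * x ^ 2 ≤ a ^ 2 := by
    calc r * x ^ 2 ≤ 1 * a ^ 2 := by gcongr
      _ = a ^ 2 := one_mul _
  have e0 := mul_le_mul_of_nonneg_left h0 (sub_nonneg.2 hr1)
  have e1 := mul_le_mul_of_nonneg_left h1 (by positivity : 0 ≤ r * x + a)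
  have e2 := mul_le_mul_of_nonneg_left h2 (by linarith : 0 ≤ (a ^ 2 - r * x ^ 2) / 2)
  have e3 := mul_le_mul_of_nonneg_left h3 (by positivity : 0 ≤ (r * x ^ 3 + a ^ 3) / 6)
  have e4 := mul_le_mul_of_nonneg_left h4 (by positivity : 0 ≤ a ^ 4 / 24)
  have e5 := mul_le_mul_of_nonneg_left hw hr0
  ring_nf at h hz e0 e1 e2 e3 e4 e5 ⊢
  linarith

lemma exp_le_one_add_add_sq {t : ℝ} (h0 : 0 ≤ t) (h1 : t ≤ 0.17) :
    exp t ≤ 1 + t + 0.53 * t ^ 2 := by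
  have h := exp_bound' h0 (h1.trans (by norm_num)) (n := 4) (by norm_num)
  simp only [Finset.sum_range_succ, Finset.sum_range_zero, Nat.factorial] at h
  norm_num at h
  have : 0 ≤ t ^ 2 * (0.03 - t / 6 - 5 / 96 * t ^ 2) := by
    have : t ^ 2 ≤ 0.17 ^ 2 := by gcongr
    exact mul_nonneg (sq_nonneg t) (by norm_num at *; linarith)
  linarith

/-- The first inequality in `IsComparisonScale` for `w ^ 2 = u * v`. -/
lemma two_mul_mills_mul_exp_le {u a v e r' t g δ : ℝ} (hu : 0 < u) (ha : 0 ≤ a) (hv : 0 < v)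
    (he0 : 0 < e) (he : e ≤ exp (u ^ 2 / 2)) (hr' : mills a ≤ mills 0 * r') (hg : g ≤ t)
    (hg0 : 0 ≤ g) (hδ : mills u - mills (u + 2 * a) ≤ δ)
    (hP : 0 ≤ 2.506628 * e * (v - (u + a) * r' * t) - v * δ) :
    2 * (u + a) * mills a * (exp (u ^ 2 / 2) * g) ≤ v * (mills (-u) + mills (u + 2 * a)) := by
  have hRa := mills_pos a
  have hR0 := mills_zero_bounds.1
  have hδ0 : 0 ≤ δ := by
    have := mills_antitone (by linarith : u ≤ u + 2 * a)
    linarith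
  have hbr : 0 ≤ v - (u + a) * r' * t := by
    have := mul_nonneg hv.le hδ0
    exact nonneg_of_mul_nonneg_right (by linarith :
      0 ≤ 2.506628 * e * (v - (u + a) * r' * t)) (by positivity)
  have h1 : 2.506628 * e * (v - (u + a) * r' * t) ≤
      2 * mills 0 * exp (u ^ 2 / 2) * (v - (u + a) * r' * t) := by
    have : 2.506628 * e ≤ 2 * mills 0 * exp (u ^ 2 / 2) :=
      mul_le_mul (by linarith) he he0.le (by linarith)
    exact mul_le_mul_of_nonneg_right this hbr
  have h2 := mul_le_mul_of_nonneg_left hδ hv.le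
  have h3 : mills a * g ≤ mills 0 * r' * t :=
    mul_le_mul hr' hg hg0 (hRa.le.trans hr')
  have h4 := mul_le_mul_of_nonneg_left h3
    (by positivity : 0 ≤ 2 * (u + a) * exp (u ^ 2 / 2))
  rw [mills_neg_eq]
  linarith

/-- A scale of the form `√(u ^ 2 + 2 * a * b * u)`, for which both inequalities become equalities as
`a → 0`. -/
lemma isComparisonScale_sqrt {u a b e r r' t f₀ f₁ f₂ f₃ f₄ k₁ k₂ k₃ k₄ k₅ : ℝ} (hu : 0 < u)
    (ha : 0 ≤ a) (hb0 : 0 ≤ b) (hb1 : b ≤ 1) (he0 : 0 < e) (he : e ≤ exp (u ^ 2 / 2))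
    (hr : mills 0 * r ≤ mills a) (hr0 : 0 ≤ r) (hr1 : r ≤ 1) (hr' : mills a ≤ mills 0 * r')
    (ht : exp (a * b * u) ≤ t)
    (hf₀ : mills (u + a) ≤ f₀) (hf₁ : f₁ ≤ millsMoment 1 (u + a))
    (hf₂ : millsMoment 2 (u + a) ≤ f₂) (hf₃ : f₃ ≤ millsMoment 3 (u + a))
    (hf₄ : millsMoment 4 (u + a) ≤ f₄)
    (hk₁ : millsMoment 1 u ≤ k₁) (hk₂ : k₂ ≤ millsMoment 2 u) (hk₃ : millsMoment 3 u ≤ k₃)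
    (hk₄ : k₄ ≤ millsMoment 4 u) (hk₅ : millsMoment 5 u ≤ k₅)
    (hP : 0 ≤ 2.506628 * e * ((u + 2 * a * b) - (u + a) * r' * t) -
      (u + 2 * a * b) * (2 * a * k₁ - 2 * a ^ 2 * k₂ + 4 / 3 * a ^ 3 * k₃ - 2 / 3 * a ^ 4 * k₄ +
        4 / 15 * a ^ 5 * k₅))
    (hQ : 0 ≤ r * (f₀ + a * (1 - b) * f₁ + (a * (1 - b)) ^ 2 / 2 * f₂ +
        (a * (1 - b)) ^ 3 / 6 * f₃) -
      (f₀ - a * f₁ + a ^ 2 / 2 * f₂ - a ^ 3 / 6 * f₃ + a ^ 4 / 24 * f₄)) :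
    IsComparisonScale u a √(u * (u + 2 * a * b)) := by
  have hub : 0 < u + 2 * a * b := by positivity
  have hδ := mills_sub_mills_add_le ha hk₁ hk₂ hk₃ hk₄ hk₅
  have hfirst := two_mul_mills_mul_exp_le hu ha hub he0 he hr' ht (exp_pos _).le hδ hP
  have h := mills_add_le_mul_mills_sub ha (mul_nonneg ha (sub_nonneg.2 hb1))
    (mul_le_of_le_one_right ha (by linarith)) hr0 hr1 hf₀ hf₁ hf₂ hf₃ hf₄ hQ
  rw [show u + a + a = u + 2 * a by ring, show u + a - a * (1 - b) = u + a * b by ring] at h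
  clear hP hQ hδ hf₀ hf₁ hf₂ hf₃ hf₄ hk₁ hk₂ hk₃ hk₄ hk₅
  have hRa := mills_pos a
  have hR0 := mills_pos 0
  set w := √(u * (u + 2 * a * b)) with hw
  have hw2 : w ^ 2 = u * (u + 2 * a * b) := sq_sqrt (by positivity)
  have hwle : w ≤ u + a * b := sqrt_le_iff.2 ⟨by positivity, by nlinarith [sq_nonneg (a * b)]⟩
  have hexp : exp (w ^ 2 / 2) = exp (u ^ 2 / 2) * exp (a * b * u) := by
    rw [hw2, ← exp_add]
    ring_nf
  have hprod : mills 0 * mills (u + 2 * a) ≤ mills a * mills w := by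
    calc mills 0 * mills (u + 2 * a) ≤ mills 0 * (r * mills (u + a * b)) := by gcongr
      _ = mills 0 * r * mills (u + a * b) := by ring
      _ ≤ mills a * mills w := by
        have := mills_antitone hwle
        have := (mills_pos (u + a * b)).le
        gcongr
  rw [← hexp] at hfirst
  have hw0 : 0 < w := sqrt_pos.2 (by positivity)
  refine ⟨hw0, ?_, ?_⟩
  · calc 2 * u * (u + a) * mills a * exp (w ^ 2 / 2)
        = u * (2 * (u + a) * mills a * exp (w ^ 2 / 2)) := by ring
      _ ≤ u * ((u + 2 * a * b) * (mills (-u) + mills (u + 2 * a))) := by gcongr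
      _ = w ^ 2 * (mills (-u) + mills (u + 2 * a)) := by rw [hw2]; ring
  · have hRw := (mills_pos w).le
    calc 2 * mills 0 * u * (u + a) * mills (u + 2 * a) * exp (w ^ 2 / 2)
        = 2 * u * (u + a) * exp (w ^ 2 / 2) * (mills 0 * mills (u + 2 * a)) := by ring
      _ ≤ 2 * u * (u + a) * exp (w ^ 2 / 2) * (mills a * mills w) := by gcongr
      _ = u * mills w * (2 * (u + a) * mills a * exp (w ^ 2 / 2)) := by ring
      _ ≤ u * mills w * ((u + 2 * a * b) * (mills (-u) + mills (u + 2 * a))) := by gcongr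
      _ = w ^ 2 * mills w * (mills (-u) + mills (u + 2 * a)) := by rw [hw2]; ring

lemma millsMoment_five (u : ℝ) :
    millsMoment 5 u = (u ^ 4 + 9 * u ^ 2 + 8) - (u ^ 5 + 10 * u ^ 3 + 15 * u) * mills u := by
  rw [millsMoment_add_two 3 u, millsMoment_four, millsMoment_three]
  push_cast
  ring

lemma mills_zero_mul_le {a : ℝ} (h1 : 0 ≤ a) (h2 : a ≤ 0.6) :
    mills 0 * (1 - 0.79789 * a + a ^ 2 / 2 - 0.26597 * a ^ 3 + 0.095 * a ^ 4) ≤ mills a := by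
  have h3 := neg_one_pow_mul_mills_add_sub_sum_nonneg 8 0 h1
  obtain ⟨e1, e2, e3, e4, e5, e6, e7, -, -⟩ := millsMoment_zero_right
  have e0 : millsMoment 0 0 = mills 0 := rfl
  simp only [Finset.sum_range_succ, Finset.sum_range_zero, Nat.factorial, zero_add, e0, e1, e2,
    e3, e4, e5, e6, e7] at h3
  norm_num at h3
  have h4 := mul_le_mul_of_nonneg_right mills_zero_bounds.1
    (by positivity : 0 ≤ 0.79789 * a + 0.26597 * a ^ 3 + 0.03 * a ^ 4 + a ^ 6 / 48)
  have h5 : 0 ≤ 1.253314 * (0.79789 * a + 0.26597 * a ^ 3 + 0.03 * a ^ 4 + a ^ 6 / 48) -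
      (a + a ^ 3 / 3 + a ^ 5 / 15 + a ^ 7 / 105) := by
    have h := bernsteinForm_nonneg h1 (sub_nonneg.2 h2)
      [0, 19563425, 117380550, 304572184, 24123386336, 46223080029, 26746676236, 3144227484]
    have hc : (0 : ℝ) ≤ 1 / 136080000000 := by norm_num
    refine (mul_nonneg hc h).trans_eq ?_
    simp only [bernsteinForm, List.length_cons, List.length_nil]
    ring
  linarith

lemma mills_le_mills_zero_mul {a : ℝ} (h1 : 0 ≤ a) (h2 : a ≤ 0.6) :
    mills a ≤ mills 0 * (1 - 0.79788 * a + a ^ 2 / 2 - 0.2625 * a ^ 3 + 0.1 * a ^ 4) := by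
  have h3 := neg_one_pow_mul_mills_add_sub_sum_nonneg 7 0 h1
  obtain ⟨e1, e2, e3, e4, e5, e6, -, -, -⟩ := millsMoment_zero_right
  have e0 : millsMoment 0 0 = mills 0 := rfl
  simp only [Finset.sum_range_succ, Finset.sum_range_zero, Nat.factorial, zero_add, e0, e1, e2,
    e3, e4, e5, e6] at h3
  norm_num at h3
  have h4 := mul_le_mul_of_nonneg_right mills_zero_bounds.2
    (by positivity : 0 ≤ 0.79788 * a + 0.2625 * a ^ 3 + 0.025 * a ^ 4 + a ^ 6 / 48)
  have h5 : 0 ≤ a + a ^ 3 / 3 + a ^ 5 / 15 -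
      1.253315 * (0.79788 * a + 0.2625 * a ^ 3 + 0.025 * a ^ 4 + a ^ 6 / 48) := by
    have h := bernsteinForm_nonneg h1 (sub_nonneg.2 h2)
      [0, 50278, 905004, 23309859, 223225038, 1099144530, 3259484151, 6161394603, 7300585188,
        4703077236, 828921665, 1008942363, 6431461374, 11881499994, 12249124713, 8164785885,
        3635520240, 1054186650, 181248915, 14084890]
    have hc : (0 : ℝ) ≤ 390625 / 396718580736 := by norm_num
    refine (mul_nonneg hc h).trans_eq ?_
    simp only [bernsteinForm, List.length_cons, List.length_nil]
    ring
  linarith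

lemma quadratic_le_exp_of_mem_1_125 {u : ℝ} (h1 : 1 ≤ u) (h2 : u ≤ 1.25) :
    0 < 2.19194 - 2.6885 * u + 2.1442 * u ^ 2 ∧
      2.19194 - 2.6885 * u + 2.1442 * u ^ 2 ≤ exp (u ^ 2 / 2) := by
  have h3 : (1.64872 : ℝ) ≤ exp (1 / 2) := by
    refine le_trans ?_ (sum_le_exp_of_nonneg (by norm_num) 9)
    norm_num [Finset.sum_range_succ, Nat.factorial]
  have hd : 0 ≤ u ^ 2 / 2 - 1 / 2 := by
    have : (1 : ℝ) ^ 2 ≤ u ^ 2 := by gcongr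
    linarith
  have h4 := sum_le_exp_of_nonneg hd 5
  have h5 : exp (u ^ 2 / 2) = exp (1 / 2) * exp (u ^ 2 / 2 - 1 / 2) := by
    rw [← exp_add]
    ring_nf
  have h6 := mul_le_mul h3 h4 (Finset.sum_nonneg fun _ _ => by positivity) (exp_pos _).le
  rw [← h5] at h6
  simp only [Finset.sum_range_succ, Finset.sum_range_zero, Nat.factorial] at h6
  constructor
  · refine lt_of_lt_of_le (by norm_num : (0 : ℝ) < 1) (sub_nonneg.1 ?_)
    have h := bernsteinForm_nonneg (sub_nonneg.2 h1) (sub_nonneg.2 h2)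
      [259056, 678102, 472651]
    have hc : (0 : ℝ) ≤ 1 / 25000 := by norm_num
    refine (mul_nonneg hc h).trans_eq ?_
    simp only [bernsteinForm, List.length_cons, List.length_nil]
    ring
  · have h7 : 0 ≤ 1.64872 * (1 + (u ^ 2 / 2 - 1 / 2) + (u ^ 2 / 2 - 1 / 2) ^ 2 / 2 +
        (u ^ 2 / 2 - 1 / 2) ^ 3 / 6 + (u ^ 2 / 2 - 1 / 2) ^ 4 / 24) -
        (2.19194 - 2.6885 * u + 2.1442 * u ^ 2) := by
      have h := bernsteinForm_nonneg (sub_nonneg.2 h1) (sub_nonneg.2 h2)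
        [339738624, 6557270016, 26646675456, 46605271040, 39893114880, 16079688704, 3433496064,
          1871761440, 800986785]
      have hc : (0 : ℝ) ≤ 1 / 4800000 := by norm_num
      refine (mul_nonneg hc h).trans_eq ?_
      simp only [bernsteinForm, List.length_cons, List.length_nil]
      ring
    norm_num at h6
    linarith

lemma quadratic_le_exp_of_mem_125_152 {u : ℝ} (h1 : 1.25 ≤ u) (h2 : u ≤ 1.52) :
    0 < 4.90019 - 6.9669 * u + 3.8345 * u ^ 2 ∧
      4.90019 - 6.9669 * u + 3.8345 * u ^ 2 ≤ exp (u ^ 2 / 2) := by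
  have h3 : (2.1842 : ℝ) ≤ exp (25 / 32) := by
    refine le_trans ?_ (sum_le_exp_of_nonneg (by norm_num) 9)
    norm_num [Finset.sum_range_succ, Nat.factorial]
  have hd : 0 ≤ u ^ 2 / 2 - 25 / 32 := by
    have : (1.25 : ℝ) ^ 2 ≤ u ^ 2 := by gcongr
    linarith
  have h4 := sum_le_exp_of_nonneg hd 5
  have h5 : exp (u ^ 2 / 2) = exp (25 / 32) * exp (u ^ 2 / 2 - 25 / 32) := by
    rw [← exp_add]
    ring_nf
  have h6 := mul_le_mul h3 h4 (Finset.sum_nonneg fun _ _ => by positivity) (exp_pos _).le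
  rw [← h5] at h6
  simp only [Finset.sum_range_succ, Finset.sum_range_zero, Nat.factorial] at h6
  constructor
  · refine lt_of_lt_of_le (by norm_num : (0 : ℝ) < 1) (sub_nonneg.1 ?_)
    have h := bernsteinForm_nonneg (sub_nonneg.2 h1) (sub_nonneg.2 h2)
      [876275, 2276420, 1607208]
    have hc : (0 : ℝ) ≤ 1 / 54000 := by norm_num
    refine (mul_nonneg hc h).trans_eq ?_
    simp only [bernsteinForm, List.length_cons, List.length_nil]
    ring
  · have h7 : 0 ≤ 2.1842 * (1 + (u ^ 2 / 2 - 25 / 32) + (u ^ 2 / 2 - 25 / 32) ^ 2 / 2 +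
        (u ^ 2 / 2 - 25 / 32) ^ 3 / 6 + (u ^ 2 / 2 - 25 / 32) ^ 4 / 24) -
        (4.90019 - 6.9669 * u + 3.8345 * u ^ 2) := by
      have h := bernsteinForm_nonneg (sub_nonneg.2 h1) (sub_nonneg.2 h2)
        [7864000000000000000, 278139200000000000000, 1865518756000000000000,
          5832497089650000000000, 10328748143161818750000, 10925228759477733750000,
          6670687419440864715000, 1947683775374416896000, 77657630517695153667,
          44036753747418735001, 107730088168767268001, 30620459039576505667]
      have hc : (0 : ℝ) ≤ 25 / 88944969064888368 := by norm_num
      refine (mul_nonneg hc h).trans_eq ?_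
      simp only [bernsteinForm, List.length_cons, List.length_nil]
      ring
    norm_num at h6
    linarith

lemma mills_le_linear_of_mem_1_125 {u : ℝ} (h1 : 1 ≤ u) (h2 : u ≤ 1.25) :
    mills u ≤ 0.96498 - 0.309 * u := by
  have hu : 0 ≤ u := le_trans (by norm_num) h1
  have hD := mul_mills_le_of_one_le (le_trans (by norm_num) h1)
  have hD0 : 0 < u ^ 3 + 3.5608 * u ^ 2 + 6.364 * u + 4.3183 := by positivity
  refine le_of_mul_le_mul_left (hD.trans (sub_nonneg.1 ?_)) hD0
  have h := bernsteinForm_nonneg (sub_nonneg.2 h1) (sub_nonneg.2 h2)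
    [17874952, 614805796, 1289593472, 720562664, 23071911]
  have hc : (0 : ℝ) ≤ 1 / 15625000 := by norm_num
  refine (mul_nonneg hc h).trans_eq ?_
  simp only [bernsteinForm, List.length_cons, List.length_nil]
  ring

lemma mills_le_linear_of_mem_125_152 {u : ℝ} (h1 : 1.25 ≤ u) (h2 : u ≤ 1.52) :
    mills u ≤ 0.88873 - 0.248 * u := by
  have hu : 0 ≤ u := le_trans (by norm_num) h1
  have hD := mul_mills_le_of_one_le (le_trans (by norm_num) h1)
  have hD0 : 0 < u ^ 3 + 3.5608 * u ^ 2 + 6.364 * u + 4.3183 := by positivity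
  refine le_of_mul_le_mul_left (hD.trans (sub_nonneg.1 ?_)) hD0
  have h := bernsteinForm_nonneg (sub_nonneg.2 h1) (sub_nonneg.2 h2)
    [4806648125, 149484864875, 315277266378, 181080131000, 9382769972]
  have hc : (0 : ℝ) ≤ 1 / 4428675000 := by norm_num
  refine (mul_nonneg hc h).trans_eq ?_
  simp only [bernsteinForm, List.length_cons, List.length_nil]
  ring

lemma le_mills_neg {u e m : ℝ} (he0 : 0 ≤ e) (he : e ≤ exp (u ^ 2 / 2)) (hm : mills u ≤ m) :
    2.506628 * e - m ≤ mills (-u) := by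
  have h := mills_zero_bounds.1
  have : 2.506628 * e ≤ 2 * mills 0 * exp (u ^ 2 / 2) :=
    mul_le_mul (by linarith) he he0 (by linarith)
  rw [mills_neg_eq]
  linarith

lemma cubic_le_mills_neg {u : ℝ} (h1 : 0 ≤ u) (h2 : u ≤ 1.05) :
    1.2415 + 1.124 * u + 0.078 * u ^ 2 + 1.027 * u ^ 3 ≤ mills (-u) := by
  have h3 := sum_mul_millsMoment_le_mills_sub 10 0 h1
  obtain ⟨e1, e2, e3, e4, e5, e6, e7, e8, e9⟩ := millsMoment_zero_right
  have e0 : millsMoment 0 0 = mills 0 := rfl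
  simp only [Finset.sum_range_succ, Finset.sum_range_zero, Nat.factorial, zero_sub, e0, e1, e2,
    e3, e4, e5, e6, e7, e8, e9] at h3
  norm_num at h3
  have h4 := mul_le_mul_of_nonneg_right mills_zero_bounds.1
    (by positivity : 0 ≤ 1 + u ^ 2 / 2 + u ^ 4 / 8 + u ^ 6 / 48 + u ^ 8 / 384)
  have h5 : 0 ≤ 1.253314 * (1 + u ^ 2 / 2 + u ^ 4 / 8 + u ^ 6 / 48 + u ^ 8 / 384) +
      (u + u ^ 3 / 3 + u ^ 5 / 15 + u ^ 7 / 105 + u ^ 9 / 945) -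
        (1.2415 + 1.124 * u + 0.078 * u ^ 2 + 1.027 * u ^ 3) := by
    rcases le_total u 0.6 with hm | hm
    · have h := bernsteinForm_nonneg h1 (sub_nonneg.2 hm)
        [689150000000, 1862350000000, 1611197000000, 8280979000000, 34493818730000,
          61417103650000, 56431975203800, 28031095011400, 7072728192071, 707963544471]
      have hc : (0 : ℝ) ≤ 1 / 587865600000 := by norm_num
      refine (mul_nonneg hc h).trans_eq ?_
      simp only [bernsteinForm, List.length_cons, List.length_nil]
      ring
    · have h := bernsteinForm_nonneg (sub_nonneg.2 hm) (sub_nonneg.2 h2)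
        [15465699616817152, 220499387966881792, 1425442012317827072, 5513422464357949440,
          14159546402047002112, 25275957603069765632, 31781626247934064448, 27703750648649268768,
          15760300296709964325, 4935331450952348803, 484690466185691017, 363280388763317711,
          746933586052252431, 491892759895643785, 147804529919620931, 17674537128063557]
      have hc : (0 : ℝ) ≤ 20 / 160137547184727 := by norm_num
      refine (mul_nonneg hc h).trans_eq ?_
      simp only [bernsteinForm, List.length_cons, List.length_nil]
      ring
  linarith

lemma isComparisonScale_of_le_of_le {u a : ℝ}
    (h1 : 0 ≤ u) (h2 : u ≤ 1.05) (h3 : 0 ≤ a) (h4 : a ≤ 0.6) :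
    IsComparisonScale u a 1.235 := by
  have hm := le_mul_mills_of_one_le (u := 1.235) (by norm_num)
  have h0 := mills_zero_bounds.2
  have he : exp (1.235 ^ 2 / 2) ≤ 1.40562 * 1.235 ^ 2 := by
    refine (exp_bound' (by norm_num) (by norm_num) (n := 9) (by norm_num)).trans ?_
    norm_num [Finset.sum_range_succ, Nat.factorial]
  refine isComparisonScale_of_rational_bounds (K := 1.40562) (K₂ := 6.04757)
    (q := 1.2415 + 1.124 * u + 0.078 * u ^ 2 + 1.027 * u ^ 3)
    h1 h3 (by norm_num) (by norm_num) he
    (by linarith) (by positivity) (cubic_le_mills_neg h1 h2) ?_ ?_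
  · have h := bernsteinForm₂_nonneg h1 (sub_nonneg.2 h2)
      h3 (sub_nonneg.2 h4)
      [[1171573067520000000, 9358190993392000000, 31361696955776000000, 56449083065844160000,
        57559381051299136000, 31526958920940992000, 7247760404142016000],
       [8747800900690000000, 68970726273074832000, 227638087446886363200, 402599102037600062720,
        402427814228726360832, 215586892920819160704, 48371273021174051392],
       [25687227745347656000, 199031885820856092000, 644272189394886314400,
        1115245221588115769152, 1088891712712055767296, 568718790329436368736,
        124193790203788892192],
       [37260397995341072200, 282262126618366535960, 891497214980630354560,
        1502719002671034761248, 1426034764527106419800, 722663854813193410696,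
        152895638813689021344],
       [27085421098211104120, 199067933657006474616, 608597949869540652810, 990725946667489728200,
        905977731081830229828, 441557805856403203536, 89715413049238699594],
       [8547087374637726290, 60063404251169978922, 174841534939231422831, 269813638109168878528,
        232889965589662910076, 106748708185978580622, 20359612268239458875],
       [707477236699792120, 4498882238810847016, 11629011527377073156, 15573398568618066744,
        11365540950005584984, 4305163444524365600, 679121009328109100]]
    have hc : (0 : ℝ) ≤ 1 / 833646696120000 := by norm_num
    refine (mul_nonneg hc h).trans_eq ?_
    simp only [bernsteinForm₂, bernsteinForm, List.length_cons, List.length_nil]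
    ring
  · have h := bernsteinForm₂_nonneg h1 (sub_nonneg.2 h2)
      h3 (sub_nonneg.2 h4)
      [[13983830400000, 59045984640000, 85477785984000, 42703964544000],
       [105474819680000, 419834872691520, 572741292809472, 268434468700352],
       [288264544302160, 1092112959072864, 1412620958126928, 624872201852224],
       [362029353370364, 1298046056012628, 1582431576197748, 658239219744284],
       [205457653551212, 679455451648212, 761341205497380, 292425792014780],
       [40240219737691, 110837096617953, 102575993523825, 34533333577963],
       [1506394639133, 2507720274375, 2713003236087, 2673093716045]]
    have hc : (0 : ℝ) ≤ 1 / 308758035600 := by norm_num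
    refine (mul_nonneg hc h).trans_eq ?_
    simp only [bernsteinForm₂, bernsteinForm, List.length_cons, List.length_nil]
    ring

lemma isComparisonScale_of_le_one {u a : ℝ}
    (h1 : 0 ≤ u) (h2 : u ≤ 1) (h3 : 0.6 ≤ a) :
    IsComparisonScale u a 1.235 := by
  have hm := le_mul_mills_of_one_le (u := 1.235) (by norm_num)
  have h0 := mills_zero_bounds.2
  have he : exp (1.235 ^ 2 / 2) ≤ 1.40562 * 1.235 ^ 2 := by
    refine (exp_bound' (by norm_num) (by norm_num) (n := 9) (by norm_num)).trans ?_
    norm_num [Finset.sum_range_succ, Nat.factorial]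
  refine isComparisonScale_of_rational_bounds (K := 1.40562) (K₂ := 6.04757)
    (q := 1.2415 + 1.124 * u + 0.078 * u ^ 2 + 1.027 * u ^ 3)
    h1 (le_trans (by norm_num) h3) (by norm_num) (by norm_num) he
    (by linarith) (by positivity) (cubic_le_mills_neg h1 (h2.trans (by norm_num))) ?_ ?_
  · have h := bernsteinForm₂_nonneg h1 (sub_nonneg.2 h2)
      (sub_nonneg.2 h3) zero_le_one
      [[16986938447207850, 46717201187152750, 56256461645341250, 37695963680368750,
        14784992020375000, 3232474500000000, 310375000000000],
       [112825002550037179, 291029115540916960, 326480299447288275, 203692378642006000,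
        74974821075340000, 15637247780000000, 1440440000000000],
       [290302719970743475, 692859347811259700, 714783296581779125, 411460093214103750,
        142106649265575000, 28558830400000000, 2566075000000000],
       [362329523163642910, 782497455345384950, 725849435219176250, 380287179977867500,
        124519059703150000, 25112164800000000, 2324150000000000],
       [220922241683949670, 413543773418437500, 329556967215611750, 155311222194008750,
        52232077088775000, 12253997300000000, 1324775000000000],
       [56086075524088215, 81515290714740650, 49911060304979875, 24716506058012500,
        13361981375950000, 4615429900000000, 601450000000000],
       [3395210477117309, 2353238634192610, 1833133809962275, 4260879339404750, 3732143779715000,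
        1319540280000000, 164815000000000]]
    have hc : (0 : ℝ) ≤ 1 / 31250000000000 := by norm_num
    refine (mul_nonneg hc h).trans_eq ?_
    simp only [bernsteinForm₂, bernsteinForm, List.length_cons, List.length_nil]
    ring
  · have h := bernsteinForm₂_nonneg h1 (sub_nonneg.2 h2)
      (sub_nonneg.2 h3) zero_le_one
      [[100087416900, 166539483000, 105483765000, 24830000000],
       [627780486749, 912769142805, 524035125650, 110984300000],
       [1474451993405, 1848550718500, 956686733250, 184031500000],
       [1599512637155, 1655483514950, 777397546500, 143423000000],
       [772969412025, 584901986900, 280977021500, 63473000000],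
       [126772596360, 48352486925, 69235298250, 26861500000],
       [9124397934, 16612956280, 27520450650, 8934300000]]
    have hc : (0 : ℝ) ≤ 1 / 2500000000 := by norm_num
    refine (mul_nonneg hc h).trans_eq ?_
    simp only [bernsteinForm₂, bernsteinForm, List.length_cons, List.length_nil]
    ring

lemma isComparisonScale_of_mem_1_125 {u a : ℝ}
    (h1 : 1 ≤ u) (h2 : u ≤ 1.25) (h3 : 0.6 ≤ a) :
    IsComparisonScale u a 1.3 := by
  obtain ⟨he0, he1⟩ := quadratic_le_exp_of_mem_1_125 h1 h2
  have hq : 0 ≤ 2.506628 * (2.19194 - 2.6885 * u + 2.1442 * u ^ 2) - (0.96498 - 0.309 * u) := by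
    have h := bernsteinForm_nonneg (sub_nonneg.2 h1) (sub_nonneg.2 h2)
      [347404055792, 802791965014, 488979857707]
    have hc : (0 : ℝ) ≤ 1 / 6250000000 := by norm_num
    refine (mul_nonneg hc h).trans_eq ?_
    simp only [bernsteinForm, List.length_cons, List.length_nil]
    ring
  have hm := le_mul_mills_of_one_le (u := 1.3) (by norm_num)
  have h0 := mills_zero_bounds.2
  have he : exp (1.3 ^ 2 / 2) ≤ 1.37751 * 1.3 ^ 2 := by
    refine (exp_bound' (by norm_num) (by norm_num) (n := 9) (by norm_num)).trans ?_
    norm_num [Finset.sum_range_succ, Nat.factorial]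
  refine isComparisonScale_of_rational_bounds (K := 1.37751) (K₂ := 6.1128)
    (q := 2.506628 * (2.19194 - 2.6885 * u + 2.1442 * u ^ 2) - (0.96498 - 0.309 * u))
    (le_trans (by norm_num) h1) (le_trans (by norm_num) h3) (by norm_num) (by norm_num) he
    (by linarith) hq (le_mills_neg he0.le he1 (mills_le_linear_of_mem_1_125 h1 h2)) ?_ ?_
  · have h := bernsteinForm₂_nonneg (sub_nonneg.2 h1) (sub_nonneg.2 h2)
      (sub_nonneg.2 h3) zero_le_one
      [[80768674214431896759168, 108019065063927631051520, 107705842748935287804800,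
        115111864205693874912000, 75730324004946244480000, 24089378651100160000000,
        2876082231680000000000],
       [272559949927185746772880, 296690335198390018316000, 407053354234587406122000,
        590512889437371187660000, 417740081187854471600000, 134023998679827200000000,
        15944745295600000000000],
       [323701886258900278215780, 277799439837499082368400, 804131255955271273246500,
        1396169897952763282530000, 987204065965222955000000, 310568498948130000000000,
        36361836805000000000000],
       [154025102218220863117840, 164376041498815244442400, 1080736903602907920398000,
        1814280980921436880350000, 1217146551807904605200000, 368959170503703400000000,
        42177860958200000000000],
       [24084762580872865623145, 143691744446016139831000, 840082601114407141573625,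
        1227004331435092001690000, 765052595350236384400000, 221861945626824800000000,
        24668781525400000000000],
       [1987593856675052629248, 68472056005693561742520, 264143556925925027276800,
        333494847605716481747000, 193100352324646507080000, 53536654042524360000000,
        5784094308280000000000]]
    have hc : (0 : ℝ) ≤ 1 / 488281250000000000 := by norm_num
    refine (mul_nonneg hc h).trans_eq ?_
    simp only [bernsteinForm₂, bernsteinForm, List.length_cons, List.length_nil]
    ring
  · have h := bernsteinForm₂_nonneg (sub_nonneg.2 h1) (sub_nonneg.2 h2)
      (sub_nonneg.2 h3) zero_le_one
      [[68093717429728512, 152938355438448640, 385375232755635200, 133644978534400000],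
       [329036589167739680, 1651057416477100800, 4199446901738960000, 1437486116320000000],
       [450524883072827040, 9002159703625901600, 21035071699768072000, 7030845247984000000],
       [53096112496278930, 31072560974961174800, 63385823404400240000, 20534659220480000000],
       [1105066953397206865, 72024262257477981600, 126543497104684912000, 39562335878464000000],
       [6445993316874114494, 114249967568108064880, 174106955358027574400, 52428789462156800000],
       [13134513980576551405, 124190538682239092800, 166632631130533120000, 48320619655840000000],
       [14082663937695037990, 90992813145382095600, 109282597253162192000, 30544126394624000000],
       [8606258359492393355, 42990098932727520800, 46927588873787920000, 12661170533440000000],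
       [2855150113114838890, 11838866472962259600, 11902656327441952000, 3105730645344000000],
       [401482175379302807, 1445267646381750240, 1353315203241259200, 342175544662400000]]
    have hc : (0 : ℝ) ≤ 4 / 152587890625 := by norm_num
    refine (mul_nonneg hc h).trans_eq ?_
    simp only [bernsteinForm₂, bernsteinForm, List.length_cons, List.length_nil]
    ring

lemma isComparisonScale_of_mem_125_152 {u a : ℝ}
    (h1 : 1.25 ≤ u) (h2 : u ≤ 1.52) (h3 : 0.6 ≤ a) :
    IsComparisonScale u a 1.35 := by
  obtain ⟨he0, he1⟩ := quadratic_le_exp_of_mem_125_152 h1 h2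
  have hq : 0 ≤ 2.506628 * (4.90019 - 6.9669 * u + 3.8345 * u ^ 2) - (0.88873 - 0.248 * u) := by
    have h := bernsteinForm_nonneg (sub_nonneg.2 h1) (sub_nonneg.2 h2)
      [24465834292225, 58130212254380, 37167829878712]
    have hc : (0 : ℝ) ≤ 1 / 364500000000 := by norm_num
    refine (mul_nonneg hc h).trans_eq ?_
    simp only [bernsteinForm, List.length_cons, List.length_nil]
    ring
  have hm := le_mul_mills_of_one_le (u := 1.35) (by norm_num)
  have h0 := mills_zero_bounds.2
  have he : exp (1.35 ^ 2 / 2) ≤ 1.36485 * 1.35 ^ 2 := by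
    refine (exp_bound' (by norm_num) (by norm_num) (n := 9) (by norm_num)).trans ?_
    norm_num [Finset.sum_range_succ, Nat.factorial]
  refine isComparisonScale_of_rational_bounds (K := 1.36485) (K₂ := 6.19945)
    (q := 2.506628 * (4.90019 - 6.9669 * u + 3.8345 * u ^ 2) - (0.88873 - 0.248 * u))
    (le_trans (by norm_num) h1) (le_trans (by norm_num) h3) (by norm_num) (by norm_num) he
    (by linarith) hq (le_mills_neg he0.le he1 (mills_le_linear_of_mem_125_152 h1 h2)) ?_ ?_
  · have h := bernsteinForm₂_nonneg (sub_nonneg.2 h1) (sub_nonneg.2 h2)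
      (sub_nonneg.2 h3) zero_le_one
      [[28766394237521109662560000, 151366063952103931465025000, 399423348733671167571000000,
        456242695370417820480625000, 254188726670779046975000000, 69199941606678575000000000,
        7405209292225000000000000],
       [112020618562619896928834375, 987251411194859260922380000, 2598876826313444718643884375,
        2844201040624288884996500000, 1529409913139864599480000000, 405324444636201910000000000,
        42539495131055000000000000],
       [428681521909773746273398150, 3234652149775330436081738000, 7368716984881496999197803750,
        7432394397674506811918650000, 3797756252051804900822000000, 972181866471456599000000000,
        99609339518527000000000000],
       [952791811853223191657216320, 5417077925193153701654742800, 10624478126728732297961760000,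
        9850938939026862874422490000, 4772625563340925557761000000, 1178017245690149672000000000,
        117643140691501000000000000],
       [927133647495299481544675952, 4328695726976387380595122240, 7545688491923147486753305200,
        6501755810915080979307080000, 2998869940965537330076000000, 714786962477344312000000000,
        69590196890516000000000000],
       [319844555819833170254378752, 1310487598605754251640595840, 2090522203757178459056467200,
        1695261544114363051216240000, 748779443207331120632000000, 172827080229127904000000000,
        16422109878712000000000000]]
    have hc : (0 : ℝ) ≤ 1 / 896806687500000000000 := by norm_num
    refine (mul_nonneg hc h).trans_eq ?_
    simp only [bernsteinForm₂, bernsteinForm, List.length_cons, List.length_nil]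
    ring
  · have h := bernsteinForm₂_nonneg (sub_nonneg.2 h1) (sub_nonneg.2 h2)
      (sub_nonneg.2 h3) zero_le_one
      [[285876811805230868125, 1519294903668005300000, 1561891911743849000000,
        407404243378000000000],
       [2727090486478836779375, 10774423346005004170000, 9850563426244100200000,
        2438134410484400000000],
       [10394771307661401690100, 31419618287529401990000, 25503911175536788280000,
        5958771361482160000000],
       [18118850353318727907880, 45247888638138157049600, 33140783928680700440000,
        7321550055320080000000],
       [14561748401111343420608, 31753465378051118627200, 21362628477008191840000,
        4482302451241280000000],
       [4397145265221147205888, 8670066585105364697600, 5437084209364028480000,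
        1088793590296960000000]]
    have hc : (0 : ℝ) ≤ 1 / 71744535000000000 := by norm_num
    refine (mul_nonneg hc h).trans_eq ?_
    simp only [bernsteinForm₂, bernsteinForm, List.length_cons, List.length_nil]
    ring

lemma isComparisonScale_of_ge {u a : ℝ}
    (h1 : 1.52 ≤ u) (h2 : 0 ≤ a) :
    IsComparisonScale u a 1.414 := by
  have hu2 : (1.52 : ℝ) ^ 2 ≤ u ^ 2 := by gcongr
  norm_num at hu2
  have h3 : (3.1746 : ℝ) ≤ exp 1.1552 := by
    refine le_trans ?_ (sum_le_exp_of_nonneg (by norm_num) 9)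
    norm_num [Finset.sum_range_succ, Nat.factorial]
  have h4 : 3.1746 * (1 + (u ^ 2 / 2 - 1.1552)) ≤ exp (u ^ 2 / 2) := by
    have h5 : exp (u ^ 2 / 2) = exp 1.1552 * exp (u ^ 2 / 2 - 1.1552) := by
      rw [← exp_add]
      ring_nf
    rw [h5, add_comm 1]
    exact mul_le_mul h3 (add_one_le_exp _) (by linarith) (exp_pos _).le
  have h6 : mills u ≤ 0.5114 := by
    have h7 := mul_mills_le_of_one_le (u := 1.52) (by norm_num)
    norm_num at h7
    exact (mills_antitone h1).trans (by linarith)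
  have hm := le_mul_mills_of_one_le (u := 1.414) (by norm_num)
  have h0 := mills_zero_bounds.2
  have he : exp (1.414 ^ 2 / 2) ≤ 1.35915 * 1.414 ^ 2 := by
    refine (exp_bound' (by norm_num) (by norm_num) (n := 9) (by norm_num)).trans ?_
    norm_num [Finset.sum_range_succ, Nat.factorial]
  refine isComparisonScale_of_rational_bounds (K := 1.35915) (K₂ := 6.35677)
    (q := 2.506628 * (3.1746 * (1 + (u ^ 2 / 2 - 1.1552))) - 0.5114)
    (le_trans (by norm_num) h1) h2 (by norm_num) (by norm_num) he
    (by linarith) (by linarith) (le_mills_neg (by linarith) h4 h6) ?_ ?_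
  · have h := bernsteinForm₂_nonneg (sub_nonneg.2 h1) zero_le_one
      h2 zero_le_one
      [[595197592597825416600, 6623420856366760924800, 20977158006293398598900,
        29007678793942026392500, 20318786590659830250000, 7196173357053000000000,
        1035726640250000000000],
       [11277885816250198740132, 76557151459399339697396, 158131207268611018566578,
        158224960930016048116600, 85686184513946166980000, 24441923139295560000000,
        2930363343180000000000],
       [14169268458321537837500, 91300488355846621880000, 164751548428452810171250,
        140176565345090467876250, 63014106502165165125000, 14353411973296500000000,
        1243365820125000000000],
       [6712508349522432066250, 42221553924857258136250, 64170069026348105343125,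
        43427832705762265750000, 14274209875977187500000, 1865048730187500000000, 0],
       [1434140143251399187500, 8883227607847000687500, 10401601978116849093750,
        4974332567594812500000, 932524365093750000000, 0, 0],
       [117149170335843750000, 725352386690343750000, 529642602516421875000,
        155420727515625000000, 0, 0, 0]]
    have hc : (0 : ℝ) ≤ 1 / 39062500000000000000 := by norm_num
    refine (mul_nonneg hc h).trans_eq ?_
    simp only [bernsteinForm₂, bernsteinForm, List.length_cons, List.length_nil]
    ring
  · have h := bernsteinForm₂_nonneg (sub_nonneg.2 h1) zero_le_one
      h2 zero_le_one
      [[516527543338998700, 2277563678102515000, 2543592205338875000, 817186265250000000],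
       [6547449249582102524, 16068831419575622800, 11769427642706340000, 2786586780680000000],
       [10116035697003329500, 17725656366765097500, 9061436369720687500, 1243365820125000000],
       [6022619555862213750, 6971496284210687500, 1865048730187500000, 0],
       [1568712397260171875, 932524365093750000, 0, 0],
       [155420727515625000, 0, 0, 0]]
    have hc : (0 : ℝ) ≤ 1 / 39062500000000000 := by norm_num
    refine (mul_nonneg hc h).trans_eq ?_
    simp only [bernsteinForm₂, bernsteinForm, List.length_cons, List.length_nil]
    ring

lemma millsMoment_bounds_105_185 {u : ℝ} (h1 : 1.05 ≤ u) (h2 : u ≤ 1.85) :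
    mills u ≤ 1.17168 - 0.7249 * u + 0.2428 * u ^ 2 - 0.034 * u ^ 3 ∧
      0.86074 - 0.7727 * u + 0.3013 * u ^ 2 - 0.0455 * u ^ 3 ≤ millsMoment 1 u ∧
      millsMoment 2 u ≤ 0.77973 - 0.6074 * u + 0.1373 * u ^ 2 ∧
      1.05856 - 0.9067 * u + 0.2153 * u ^ 2 ≤ millsMoment 3 u ∧
      millsMoment 4 u ≤ 0.96844 - 0.4352 * u := by
  have hu : 0 ≤ u := le_trans (by norm_num) h1
  have hD := mul_mills_le_of_one_le (le_trans (by norm_num) h1)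
  have hD0 : 0 < u ^ 3 + 3.5608 * u ^ 2 + 6.364 * u + 4.3183 := by positivity
  refine ⟨?_, ?_, ?_, ?_, ?_⟩
  · have e : mills u = 1 * mills u + 0 := by ring
    rw [e]
    refine mul_add_le_of_mul_le hD0
      (mul_le_mul_of_nonneg_left hD (by positivity)) ?_
    have h := bernsteinForm_nonneg (sub_nonneg.2 h1) (sub_nonneg.2 h2)
      [676227057, 97342018331, 562310516551, 1245683756053, 1180356391594, 366827404398,
        502765591534, 1758483838506, 2124025504853, 1154737645959, 266632944091, 13692512433]
    have hc : (0 : ℝ) ≤ 1 / 343597383680 := by norm_num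
    refine (mul_nonneg hc h).trans_eq ?_
    simp only [bernsteinForm, List.length_cons, List.length_nil]
    ring
  · have e : millsMoment 1 u =
        (-u) * mills u + (1) := by
      rw [millsMoment_one]
      ring
    rw [e]
    refine le_mul_add_of_le_mul hD0
      (mul_le_mul_of_nonpos_left hD (neg_nonpos.2 (by positivity))) ?_
    have h := bernsteinForm_nonneg (sub_nonneg.2 h1) (sub_nonneg.2 h2)
      [74329903473, 321074494747, 1508780977351, 8470460945173, 27517179327914, 49872346786926,
        52373922722542, 31163049519146, 9131346241493, 713534064519, 7214069083, 72307431345]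
    have hc : (0 : ℝ) ≤ 1 / 1374389534720 := by norm_num
    refine (mul_nonneg hc h).trans_eq ?_
    simp only [bernsteinForm, List.length_cons, List.length_nil]
    ring
  · have e : millsMoment 2 u =
        (1 + u ^ 2) * mills u + (-u) := by
      rw [millsMoment_two]
      ring
    rw [e]
    refine mul_add_le_of_mul_le hD0
      (mul_le_mul_of_nonneg_left hD (by positivity)) ?_
    have h := bernsteinForm_nonneg (sub_nonneg.2 h1) (sub_nonneg.2 h2)
      [9419852031, 1742614217156, 15052984951726, 57796158070484, 126636464623137,
        171366013657864, 143875349264836, 69616873105992, 14801022887729, 395824560692,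
        1784545229678, 1591768485860, 349465288911]
    have hc : (0 : ℝ) ≤ 1 / 274877906944 := by norm_num
    refine (mul_nonneg hc h).trans_eq ?_
    simp only [bernsteinForm, List.length_cons, List.length_nil]
    ring
  · have e : millsMoment 3 u =
        (-(u ^ 3 + 3 * u)) * mills u + (u ^ 2 + 2) := by
      rw [millsMoment_three]
      ring
    rw [e]
    refine le_mul_add_of_le_mul hD0
      (mul_le_mul_of_nonpos_left hD (neg_nonpos.2 (by positivity))) ?_
    have h := bernsteinForm_nonneg (sub_nonneg.2 h1) (sub_nonneg.2 h2)
      [429174846289, 13865429590, 190818062319, 7046484982452, 12073127605791, 5993596427286,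
        360826324929]
    have hc : (0 : ℝ) ≤ 1 / 1048576000000 := by norm_num
    refine (mul_nonneg hc h).trans_eq ?_
    simp only [bernsteinForm, List.length_cons, List.length_nil]
    ring
  · have e : millsMoment 4 u =
        (u ^ 4 + 6 * u ^ 2 + 3) * mills u + (-(u ^ 3 + 5 * u)) := by
      rw [millsMoment_four]
      ring
    rw [e]
    refine mul_add_le_of_mul_le hD0
      (mul_le_mul_of_nonneg_left hD (by positivity)) ?_
    have h := bernsteinForm_nonneg (sub_nonneg.2 h1) (sub_nonneg.2 h2)
      [38060597, 1106946731988, 2566621860926, 1613373415892, 112282434357]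
    have hc : (0 : ℝ) ≤ 1 / 81920000000 := by norm_num
    refine (mul_nonneg hc h).trans_eq ?_
    simp only [bernsteinForm, List.length_cons, List.length_nil]
    ring

lemma millsMoment_bounds_105_125 {u : ℝ} (h1 : 1.05 ≤ u) (h2 : u ≤ 1.25) :
    millsMoment 1 u ≤ 0.80278 - 0.6106 * u + 0.152 * u ^ 2 ∧
      0.89711 - 0.8028 * u + 0.2167 * u ^ 2 ≤ millsMoment 2 u ∧
      millsMoment 3 u ≤ 1.27805 - 1.2604 * u + 0.3592 * u ^ 2 ∧
      1.25837 - 0.719 * u ≤ millsMoment 4 u ∧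
      millsMoment 5 u ≤ 2.27638 - 1.3437 * u := by
  have hu : 0 ≤ u := le_trans (by norm_num) h1
  have hD := le_mul_mills_of_one_le (le_trans (by norm_num) h1)
  have hD0 : 0 < u ^ 3 + 4.1698 * u ^ 2 + 7.8885 * u + 5.693 := by positivity
  refine ⟨?_, ?_, ?_, ?_, ?_⟩
  · have e : millsMoment 1 u =
        (-u) * mills u + (1) := by
      rw [millsMoment_one]
      ring
    rw [e]
    refine mul_add_le_of_mul_le hD0
      (mul_le_mul_of_nonpos_left hD (neg_nonpos.2 (by positivity))) ?_
    have h := bernsteinForm_nonneg (sub_nonneg.2 h1) (sub_nonneg.2 h2)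
      [58860807, 1763806926, 4544047533, 3681788916, 799025777, 272733150, 316394875]
    have hc : (0 : ℝ) ≤ 1 / 12800000 := by norm_num
    refine (mul_nonneg hc h).trans_eq ?_
    simp only [bernsteinForm, List.length_cons, List.length_nil]
    ring
  · have e : millsMoment 2 u =
        (1 + u ^ 2) * mills u + (-u) := by
      rw [millsMoment_two]
      ring
    rw [e]
    refine le_mul_add_of_le_mul hD0
      (mul_le_mul_of_nonneg_left hD (by positivity)) ?_
    have h := bernsteinForm_nonneg (sub_nonneg.2 h1) (sub_nonneg.2 h2)
      [13446738557, 33320165205, 10714365460, 137783297220, 757485877510, 1457005462182,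
        1370229439620, 652884499540, 132913041125, 3796038125]
    have hc : (0 : ℝ) ≤ 1 / 4096000 := by norm_num
    refine (mul_nonneg hc h).trans_eq ?_
    simp only [bernsteinForm, List.length_cons, List.length_nil]
    ring
  · have e : millsMoment 3 u =
        (-(u ^ 3 + 3 * u)) * mills u + (u ^ 2 + 2) := by
      rw [millsMoment_three]
      ring
    rw [e]
    refine mul_add_le_of_mul_le hD0
      (mul_le_mul_of_nonpos_left hD (neg_nonpos.2 (by positivity))) ?_
    have h := bernsteinForm_nonneg (sub_nonneg.2 h1) (sub_nonneg.2 h2)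
      [212687229, 6980667056, 29475342584, 50147632856, 38885023314, 11186490240, 234286400,
        1399915000, 907365625]
    have hc : (0 : ℝ) ≤ 1 / 640000 := by norm_num
    refine (mul_nonneg hc h).trans_eq ?_
    simp only [bernsteinForm, List.length_cons, List.length_nil]
    ring
  · have e : millsMoment 4 u =
        (u ^ 4 + 6 * u ^ 2 + 3) * mills u + (-(u ^ 3 + 5 * u)) := by
      rw [millsMoment_four]
      ring
    rw [e]
    refine le_mul_add_of_le_mul hD0
      (mul_le_mul_of_nonneg_left hD (by positivity)) ?_
    have h := bernsteinForm_nonneg (sub_nonneg.2 h1) (sub_nonneg.2 h2)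
      [7838723593, 27564602395, 27572513525, 344259935, 2658674635, 32779458273, 31613913975,
        8995505125]
    have hc : (0 : ℝ) ≤ 1 / 640000 := by norm_num
    refine (mul_nonneg hc h).trans_eq ?_
    simp only [bernsteinForm, List.length_cons, List.length_nil]
    ring
  · have e : millsMoment 5 u =
        (-(u ^ 5 + 10 * u ^ 3 + 15 * u)) * mills u + (u ^ 4 + 9 * u ^ 2 + 8) := by
      rw [millsMoment_five]
      ring
    rw [e]
    refine mul_add_le_of_mul_le hD0
      (mul_le_mul_of_nonpos_left hD (neg_nonpos.2 (by positivity))) ?_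
    have h := bernsteinForm_nonneg (sub_nonneg.2 h1) (sub_nonneg.2 h2)
      [37278668, 240562960941, 977682420025, 1495707652434, 1025450712942, 271925775025,
        5025736125]
    have hc : (0 : ℝ) ≤ 1 / 12800000 := by norm_num
    refine (mul_nonneg hc h).trans_eq ?_
    simp only [bernsteinForm, List.length_cons, List.length_nil]
    ring

lemma isComparisonScale_sqrt_of_mem_105_125 {u a : ℝ} (h1 : 1.05 ≤ u) (h2 : u ≤ 1.25)
    (h3 : 0 ≤ a) (h4 : a ≤ 0.6) :
    IsComparisonScale u a √(u * (u + 2 * a * (0.936 - 0.507 * u - 0.234 * a))) := by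
  obtain ⟨he0, he⟩ := quadratic_le_exp_of_mem_1_125 (u := u) (le_trans (by norm_num) h1) h2
  obtain ⟨hf₀, hf₁, hf₂, hf₃, hf₄⟩ :=
    millsMoment_bounds_105_185 (u := u + a) (by linarith) (by norm_num; linarith)
  obtain ⟨hk₁, hk₂, hk₃, hk₄, hk₅⟩ := millsMoment_bounds_105_125 h1 h2
  have hb0 : 0 ≤ 0.936 - 0.507 * u - 0.234 * a := by norm_num at *; linarith
  have ht0 : 0 ≤ a * (0.936 - 0.507 * u - 0.234 * a) * u := by positivity
  have ht1 : a * (0.936 - 0.507 * u - 0.234 * a) * u ≤ a * (0.424 - 0.234 * 1.05 * a) := by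
    have hb : (0.936 - 0.507 * u - 0.234 * a) * u ≤ 0.424 - 0.234 * 1.05 * a := by
      nlinarith [mul_nonneg (sub_nonneg.2 h1) (sub_nonneg.2 h2), mul_nonneg h3 (sub_nonneg.2 h1)]
    rw [mul_assoc]
    gcongr
  have ht2 : a * (0.936 - 0.507 * u - 0.234 * a) * u ≤ 0.17 := ht1.trans (by nlinarith)
  have ht : exp (a * (0.936 - 0.507 * u - 0.234 * a) * u) ≤
      1 + a * (0.936 - 0.507 * u - 0.234 * a) * u +
        0.53 * ((a * (0.424 - 0.234 * 1.05 * a)) * (a * (0.936 - 0.507 * u - 0.234 * a) * u)) := by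
    refine (exp_le_one_add_add_sq ht0 ht2).trans ?_
    rw [sq]
    gcongr
  have ha2 : a ^ 2 ≤ 0.6 * a := by nlinarith
  have ha3 : a ^ 3 ≤ 0.6 ^ 3 := by gcongr
  have ha4 : a ^ 4 ≤ 0.6 ^ 3 * a := by
    rw [pow_succ]
    gcongr
  have hr0 : 0 ≤ 1 - 0.79789 * a + a ^ 2 / 2 - 0.26597 * a ^ 3 + 0.095 * a ^ 4 := by
    have := pow_nonneg h3 4
    norm_num at *
    linarith [sq_nonneg a]
  have hr1 : 1 - 0.79789 * a + a ^ 2 / 2 - 0.26597 * a ^ 3 + 0.095 * a ^ 4 ≤ 1 := by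
    have := pow_nonneg h3 3
    norm_num at *
    linarith
  refine isComparisonScale_sqrt (lt_of_lt_of_le (by norm_num) h1) h3 hb0 (by linarith) he0 he
    (mills_zero_mul_le h3 h4) hr0 hr1 (mills_le_mills_zero_mul h3 h4) ht
    hf₀ hf₁ hf₂ hf₃ hf₄ hk₁ hk₂ hk₃ hk₄ hk₅ ?_ ?_
  · have h := bernsteinForm₂_nonneg (sub_nonneg.2 h1) (sub_nonneg.2 h2)
      h3 (sub_nonneg.2 h4)
      [[4440716614753204456250000000000, 29883947005331704511835850000000,
        88697703206373401071651185659600, 151819683049198421878161485020282,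
        164032574155749654555554239235042, 113686861243867092293512540334839,
        47896983206017934918918624152145, 10338471233962670935300936516291,
        655149238834853471552497123505],
       [15555369391351900456250000000000, 101493051112994995706946250000000,
        292946028828206464679614536290000, 490820833457377995794688329366650,
        524233390782587650677789250637762, 361938368263866933056814200151415,
        150609567645668452430628466125473, 30159003459427787966027681119459,
        1035385456071703598240013506849],
       [19728884731170505462500000000000, 123184796742580314384730500000000,
        343791252621566062381216654068000, 568745150533281445657199075145060,
        618040014307098538157152000743540, 445054325630555164767217840152726,
        192704296487709400997922007369338, 37509229365883276002446207882958,
        160836874670582173870985506746],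
       [10699901336499395812500000000000, 63261253735054102755832500000000,
        175081749711140322427519474020000, 310169496536320060723710170778900,
        389464106609777721131912475498660, 334241502471023563871966673012510,
        171019036916152496046271783935570, 40158229991311904298808151690550,
        1491705425878927576329356229330],
       [2465390996770142781250000000000, 15410363398090248648031250000000,
        53735232171711651266454522250000, 131630199992702356497178663141250,
        218275329504003338320798541639050, 225987527356590068167464613645955,
        133537609907816369027147506998565, 38628378867874899641200170945215,
        3602717110717912160055793923205],
       [401521445731382031250000000000, 3891704070420430313281250000000,
        18755821473473076030910356250000, 52276811238679827422370207031250,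
        87935284449762407704574288976250, 89534787221084493387865502058875,
        52983358049618420062502340944125, 16288636395863447313618986360375,
        1907207146551109763652985040125]]
    have hc : (0 : ℝ) ≤ 1 / 134369280000000000000000000 := by norm_num
    refine (mul_nonneg (mul_nonneg hc h3) h).trans_eq ?_
    simp only [bernsteinForm₂, bernsteinForm, List.length_cons, List.length_nil]
    ring
  · have h := bernsteinForm₂_nonneg (sub_nonneg.2 h1) (sub_nonneg.2 h2)
      h3 (sub_nonneg.2 h4)
      [[306467117237500000000000000, 2687095067067570125000000000, 10654213583913178741570000000,
        25256201459398976992162046025, 39837878701128450441686016600,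
        43975147175299005874369625037, 34727058640576926414159194874,
        19676310242417366296363934145, 7889094612403601037779955828, 2162740865914770656348342995,
        375394050208594124014237850, 32615064629375021375389750],
       [1389822713187500000000000000, 12121008555372126625000000000,
        47932188705914525165420000000, 113758343744104652136456890625,
        180566265473127472755348269400, 201865859515518761024266229925,
        162690244807107796417335882282, 94890674691985068816217550265,
        39519741870907622784954131604, 11341482999111314879230807931,
        2065682406321869256397713610, 186592316768933930334182150],
       [2491936371975000000000000000, 21616117074816905250000000000,
        85299011154098558946300000000, 202939512553529159803166018250,
        324826150313038702326738966000, 368749624123911537504232850610,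
        304037636516110248223018593060, 182734876139557387306488608250,
        78896560685506302862815305544, 23551192981321636165809403278,
        4453769490795163431022632804, 413773350975491824297945020],
       [2207078034775000000000000000, 19040818859687641250000000000,
        75025554000207508388800000000, 179216363995384768633023971250,
        289967009445626830210867614000, 335198770419119225606163723450,
        283369248030668962026050509620, 175558599570537143478398439330,
        78368171022110275332325846248, 24185609858897933268330163078,
        4709875667295495482050216052, 446805189645501268277216812],
       [964564028187500000000000000, 8274417477830070625000000000, 32577864252144511915250000000,
        78274113508073333483921428125, 128364166955914073890040595000,
        151526801502516480278284784625, 131565676289869027122378950850,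
        83978172697431588284456767605, 38630905160102556763124781060,
        12256314176288710282991295791, 2442070937510820844144045282, 235444107882378612333760046],
       [166066769437500000000000000, 1415802204654778125000000000, 5573357058584000842500000000,
        13495211594316795978789328125, 22495269609391604137663275000,
        27187716458198108321677220625, 24271984492524756955742501250,
        15941140598179075113881882325, 7529320597522698153154780740, 2443431390765310408729349775,
        495742635956476892954868642, 48442086561783240347577582]]
    have hc : (0 : ℝ) ≤ 1 / 23219011584000000000000 := by norm_num
    refine (mul_nonneg (mul_nonneg hc h3) h).trans_eq ?_
    simp only [bernsteinForm₂, bernsteinForm, List.length_cons, List.length_nil]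
    ring

lemma millsMoment_bounds_125_212 {u : ℝ} (h1 : 1.25 ≤ u) (h2 : u ≤ 2.12) :
    mills u ≤ 1.13906 - 0.6606 * u + 0.2011 * u ^ 2 - 0.0251 * u ^ 3 ∧
      0.81059 - 0.6745 * u + 0.2377 * u ^ 2 - 0.0319 * u ^ 3 ≤ millsMoment 1 u ∧
      millsMoment 2 u ≤ 0.68084 - 0.4792 * u + 0.0963 * u ^ 2 ∧
      0.88835 - 0.6837 * u + 0.144 * u ^ 2 ≤ millsMoment 3 u ∧
      millsMoment 4 u ≤ 0.73164 - 0.2915 * u := by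
  have hu : 0 ≤ u := le_trans (by norm_num) h1
  have hD := mul_mills_le_of_one_le (le_trans (by norm_num) h1)
  have hD0 : 0 < u ^ 3 + 3.5608 * u ^ 2 + 6.364 * u + 4.3183 := by positivity
  refine ⟨?_, ?_, ?_, ?_, ?_⟩
  · have e : mills u = 1 * mills u + 0 := by ring
    rw [e]
    refine mul_add_le_of_mul_le hD0
      (mul_le_mul_of_nonneg_left hD (by positivity)) ?_
    have h := bernsteinForm_nonneg (sub_nonneg.2 h1) (sub_nonneg.2 h2)
      [110114400390625, 3282585764843750, 15068633556881250, 26681450637922500,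
        17735331722075025, 909512045289162, 7138788558757860, 21635898881702820,
        16746773234821920, 4342220275476160, 52026132307712]
    have hc : (0 : ℝ) ≤ 400 / 8280780473047856283 := by norm_num
    refine (mul_nonneg hc h).trans_eq ?_
    simp only [bernsteinForm, List.length_cons, List.length_nil]
    ring
  · have e : millsMoment 1 u =
        (-u) * mills u + (1) := by
      rw [millsMoment_one]
      ring
    rw [e]
    refine le_mul_add_of_le_mul hD0
      (mul_le_mul_of_nonpos_left hD (neg_nonpos.2 (by positivity))) ?_
    have h := bernsteinForm_nonneg (sub_nonneg.2 h1) (sub_nonneg.2 h2)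
      [211786916015625, 1339795315234375, 6507471188450000, 27342603518103750, 75406558931412525,
        126963242441875899, 129653249595329094, 77538963511320360, 24047458199626980,
        2563745888381760, 50149902838144, 128324058756224]
    have hc : (0 : ℝ) ≤ 40000 / 240142633718387832207 := by norm_num
    refine (mul_nonneg hc h).trans_eq ?_
    simp only [bernsteinForm, List.length_cons, List.length_nil]
    ring
  · have e : millsMoment 2 u =
        (1 + u ^ 2) * mills u + (-u) := by
      rw [millsMoment_two]
      ring
    rw [e]
    refine mul_add_le_of_mul_le hD0
      (mul_le_mul_of_nonneg_left hD (by positivity)) ?_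
    have h := bernsteinForm_nonneg (sub_nonneg.2 h1) (sub_nonneg.2 h2)
      [329740703125, 124586113578125, 1091410812369875, 4209515368339825, 9239730431918829,
        12505657595224407, 10484275479121437, 5050706032642299, 1059145220804730, 27759251961424,
        137232040622612, 120109656595232, 26210292800704]
    have hc : (0 : ℝ) ≤ 400000000 / 20892409133499741402009 := by norm_num
    refine (mul_nonneg hc h).trans_eq ?_
    simp only [bernsteinForm, List.length_cons, List.length_nil]
    ring
  · have e : millsMoment 3 u =
        (-(u ^ 3 + 3 * u)) * mills u + (u ^ 2 + 2) := by
      rw [millsMoment_three]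
      ring
    rw [e]
    refine le_mul_add_of_le_mul hD0
      (mul_le_mul_of_nonpos_left hD (neg_nonpos.2 (by positivity))) ?_
    have h := bernsteinForm_nonneg (sub_nonneg.2 h1) (sub_nonneg.2 h2)
      [4013845234375, 12443601331250, 1163472977625, 20077539933120, 292917466196337,
        841635651130302, 1160673320450655, 883525599814140, 365529102696600, 69412273931572,
        2797458584792]
    have hc : (0 : ℝ) ≤ 800000 / 8280780473047856283 := by norm_num
    refine (mul_nonneg hc h).trans_eq ?_
    simp only [bernsteinForm, List.length_cons, List.length_nil]
    ring
  · have e : millsMoment 4 u =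
        (u ^ 4 + 6 * u ^ 2 + 3) * mills u + (-(u ^ 3 + 5 * u)) := by
      rw [millsMoment_four]
      ring
    rw [e]
    refine mul_add_le_of_mul_le hD0
      (mul_le_mul_of_nonneg_left hD (by positivity)) ?_
    have h := bernsteinForm_nonneg (sub_nonneg.2 h1) (sub_nonneg.2 h2)
      [157510000, 4361268447125, 10099708106094, 6372224052730, 461089220216]
    have hc : (0 : ℝ) ≤ 1 / 477414675000 := by norm_num
    refine (mul_nonneg hc h).trans_eq ?_
    simp only [bernsteinForm, List.length_cons, List.length_nil]
    ring

lemma millsMoment_bounds_125_152 {u : ℝ} (h1 : 1.25 ≤ u) (h2 : u ≤ 1.52) :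
    millsMoment 1 u ≤ 0.52722 - 0.2002 * u ∧
      0.50387 - 0.2198 * u ≤ millsMoment 2 u ∧
      millsMoment 3 u ≤ 0.26366 ∧
      0.23975 ≤ millsMoment 4 u ∧
      millsMoment 5 u ≤ 0.59572 := by
  have hu : 0 ≤ u := le_trans (by norm_num) h1
  have hD := le_mul_mills_of_one_le (le_trans (by norm_num) h1)
  have hD0 : 0 < u ^ 3 + 4.1698 * u ^ 2 + 7.8885 * u + 5.693 := by positivity
  refine ⟨?_, ?_, ?_, ?_, ?_⟩
  · have e : millsMoment 1 u =
        (-u) * mills u + (1) := by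
      rw [millsMoment_one]
      ring
    rw [e]
    refine mul_add_le_of_mul_le hD0
      (mul_le_mul_of_nonpos_left hD (neg_nonpos.2 (by positivity))) ?_
    have h := bernsteinForm_nonneg (sub_nonneg.2 h1) (sub_nonneg.2 h2)
      [3516265625, 5208403176875, 11175522423060, 6095983846628, 98749712768]
    have hc : (0 : ℝ) ≤ 1 / 132860250000 := by norm_num
    refine (mul_nonneg hc h).trans_eq ?_
    simp only [bernsteinForm, List.length_cons, List.length_nil]
    ring
  · have e : millsMoment 2 u =
        (1 + u ^ 2) * mills u + (-u) := by
      rw [millsMoment_two]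
      ring
    rw [e]
    refine le_mul_add_of_le_mul hD0
      (mul_le_mul_of_nonneg_left hD (by positivity)) ?_
    have h := bernsteinForm_nonneg (sub_nonneg.2 h1) (sub_nonneg.2 h2)
      [1863813500000, 13875471998125, 42488361884240, 66262839710118, 50549077306254,
        14739144930384, 19626779030838, 62608580017050, 78955760414058, 50262059457539,
        16508823229474, 2244519251648]
    have hc : (0 : ℝ) ≤ 400000000 / 5559060566555523 := by norm_num
    refine (mul_nonneg hc h).trans_eq ?_
    simp only [bernsteinForm, List.length_cons, List.length_nil]
    ring
  · have e : millsMoment 3 u =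
        (-(u ^ 3 + 3 * u)) * mills u + (u ^ 2 + 2) := by
      rw [millsMoment_three]
      ring
    rw [e]
    refine mul_add_le_of_mul_le hD0
      (mul_le_mul_of_nonpos_left hD (neg_nonpos.2 (by positivity))) ?_
    have h := bernsteinForm_nonneg (sub_nonneg.2 h1) (sub_nonneg.2 h2)
      [221978125, 1985287918000, 6032878697931, 6117751960762, 2069855943616]
    have hc : (0 : ℝ) ≤ 1 / 4428675000 := by norm_num
    refine (mul_nonneg hc h).trans_eq ?_
    simp only [bernsteinForm, List.length_cons, List.length_nil]
    ring
  · have e : millsMoment 4 u =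
        (u ^ 4 + 6 * u ^ 2 + 3) * mills u + (-(u ^ 3 + 5 * u)) := by
      rw [millsMoment_four]
      ring
    rw [e]
    refine le_mul_add_of_le_mul hD0
      (mul_le_mul_of_nonneg_left hD (by positivity)) ?_
    have h := bernsteinForm_nonneg (sub_nonneg.2 h1) (sub_nonneg.2 h2)
      [25495289453125, 101872952937500, 152789679823375, 101937742051375, 25527911831150,
        1961319232]
    have hc : (0 : ℝ) ≤ 1 / 11957422500 := by norm_num
    refine (mul_nonneg hc h).trans_eq ?_
    simp only [bernsteinForm, List.length_cons, List.length_nil]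
    ring
  · have e : millsMoment 5 u =
        (-(u ^ 5 + 10 * u ^ 3 + 15 * u)) * mills u + (u ^ 4 + 9 * u ^ 2 + 8) := by
      rw [millsMoment_five]
      ring
    rw [e]
    refine mul_add_le_of_mul_le hD0
      (mul_le_mul_of_nonpos_left hD (neg_nonpos.2 (by positivity))) ?_
    have h := bernsteinForm_nonneg (sub_nonneg.2 h1) (sub_nonneg.2 h2)
      [73846093750, 1966219769578125, 9800599492809000, 19556635771586000, 19526579285934000,
        9755039014797600, 1950639907929088]
    have hc : (0 : ℝ) ≤ 1 / 107616802500 := by norm_num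
    refine (mul_nonneg hc h).trans_eq ?_
    simp only [bernsteinForm, List.length_cons, List.length_nil]
    ring

lemma isComparisonScale_sqrt_of_mem_125_152 {u a : ℝ} (h1 : 1.25 ≤ u) (h2 : u ≤ 1.52)
    (h3 : 0 ≤ a) (h4 : a ≤ 0.6) :
    IsComparisonScale u a √(u * (u + 2 * a * (1.043 - 0.588 * u - 0.247 * a))) := by
  obtain ⟨he0, he⟩ := quadratic_le_exp_of_mem_125_152 (u := u) (le_trans (by norm_num) h1) h2
  obtain ⟨hf₀, hf₁, hf₂, hf₃, hf₄⟩ :=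
    millsMoment_bounds_125_212 (u := u + a) (by linarith) (by norm_num; linarith)
  obtain ⟨hk₁, hk₂, hk₃, hk₄, hk₅⟩ := millsMoment_bounds_125_152 h1 h2
  have hb0 : 0 ≤ 1.043 - 0.588 * u - 0.247 * a := by norm_num at *; linarith
  have ht0 : 0 ≤ a * (1.043 - 0.588 * u - 0.247 * a) * u := by positivity
  have ht1 : a * (1.043 - 0.588 * u - 0.247 * a) * u ≤ a * (0.385 - 0.247 * 1.25 * a) := by
    have hb : (1.043 - 0.588 * u - 0.247 * a) * u ≤ 0.385 - 0.247 * 1.25 * a := by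
      nlinarith [mul_nonneg (sub_nonneg.2 h1) (sub_nonneg.2 h2), mul_nonneg h3 (sub_nonneg.2 h1)]
    rw [mul_assoc]
    gcongr
  have ht2 : a * (1.043 - 0.588 * u - 0.247 * a) * u ≤ 0.17 := ht1.trans (by nlinarith)
  have ht : exp (a * (1.043 - 0.588 * u - 0.247 * a) * u) ≤
      1 + a * (1.043 - 0.588 * u - 0.247 * a) * u +
        0.53 * ((a * (0.385 - 0.247 * 1.25 * a)) * (a * (1.043 - 0.588 * u - 0.247 * a) * u)) := by
    refine (exp_le_one_add_add_sq ht0 ht2).trans ?_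
    rw [sq]
    gcongr
  have ha2 : a ^ 2 ≤ 0.6 * a := by nlinarith
  have ha3 : a ^ 3 ≤ 0.6 ^ 3 := by gcongr
  have ha4 : a ^ 4 ≤ 0.6 ^ 3 * a := by
    rw [pow_succ]
    gcongr
  have hr0 : 0 ≤ 1 - 0.79789 * a + a ^ 2 / 2 - 0.26597 * a ^ 3 + 0.095 * a ^ 4 := by
    have := pow_nonneg h3 4
    norm_num at *
    linarith [sq_nonneg a]
  have hr1 : 1 - 0.79789 * a + a ^ 2 / 2 - 0.26597 * a ^ 3 + 0.095 * a ^ 4 ≤ 1 := by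
    have := pow_nonneg h3 3
    norm_num at *
    linarith
  refine isComparisonScale_sqrt (lt_of_lt_of_le (by norm_num) h1) h3 hb0 (by linarith) he0 he
    (mills_zero_mul_le h3 h4) hr0 hr1 (mills_le_mills_zero_mul h3 h4) ht
    hf₀ hf₁ hf₂ hf₃ hf₄ hk₁ hk₂ hk₃ hk₄ hk₅ ?_ ?_
  · have h := bernsteinForm₂_nonneg (sub_nonneg.2 h1) (sub_nonneg.2 h2)
      h3 (sub_nonneg.2 h4)
      [[19007859375365312500000000000000, 168311546349086025664062500000000,
        737170611671282659233967187500000, 1896986507649982739600425812500000,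
        2980647128478279652287353127343750, 2850504834695682237006794705000000,
        1584071372953598493749178915390625, 453061296700227687573676576718750,
        47676999340055248411506201484375],
       [20587598442912559062500000000000, 557495426679230524180234375000000,
        3692326473521710795878048621875000, 11327178197471358800776225181593750,
        19275753429997783384006946944100000, 19219011120633689209073704291920625,
        11031620676407983299618225312177500, 3299448153526541759072395312024375,
        381236944462552954274865265786250],
       [189451485214284998500000000000000, 2993937984106895039126982500000000,
        16187323085523018836630887854100000, 44329202875222657273086829019285000,
        70243843309113010640185824372535000, 67044353894395369361662814523696500,
        37748315237711163833322115125779500, 11396033919036332288363520906122000,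
        1391009117825669738048603004109000],
       [741223129179818439700000000000000, 8195767963072563582875102600000000,
        36923858989609356805672990689448000, 90420785836251894865348741014558800,
        133063766359660387431510109497580000, 120964661762237404093665400692296600,
        66253348142407825433369992117646800, 19888898956265697473556288115887800,
        2483895074831601484685403533796400],
       [951323170905910143440000000000000, 9195716154329155024694577280000000,
        37751845592646563738486440519654400, 86420845182240171259313201015280640,
        120991835728323459886579190508324800, 106106614039268528882067257192536000,
        56794648660850600858466677075832800, 16896163857914268185586728772628000,
        2127419714841243047600411511928640],
       [403040233512238425856000000000000, 3643443983104183606601626112000000,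
        14189745840929018058572702259957760, 31146847375934268133509899110931456,
        42172955032100791049544524181076480, 36044365192659514869794465901839360,
        18950413773298794048117188445840640, 5586528918131982097368092519686400,
        704518170470705929647962958670336]]
    have hc : (0 : ℝ) ≤ 1 / 15062908612320000000000000000 := by norm_num
    refine (mul_nonneg (mul_nonneg hc h3) h).trans_eq ?_
    simp only [bernsteinForm₂, bernsteinForm, List.length_cons, List.length_nil]
    ring
  · have h := bernsteinForm₂_nonneg (sub_nonneg.2 h1) (sub_nonneg.2 h2)
      h3 (sub_nonneg.2 h4)
      [[310889646453857421875000000, 2697991648079467773437500000, 10741991477287034814453125000,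
        26148152972791960473046875000, 43688643758657798649550781250,
        53103316630877696549238281250, 48220349265254309167524609375,
        32792567150568425822163046875, 16361247755648845478528671875,
        5696362754342639432660665625, 1244362904899375045549000000, 129099737927265187614818750],
       [1470797612243652343750000000, 12989137137831666259765625000,
        53355570968678715238281250000, 135973408269446123874726562500,
        240738888962194055207327343750, 311795130854875497885037734375,
        300693465428733896718052312500, 214719838958316617139912956250,
        110639886035462668062470865000, 39053083521655475900250983125,
        8497020419186700936603383750, 865061116305480750191293750],
       [2700672253968505859375000000, 24338330870110043212890625000,
        103424238777253343837363281250, 275914637067770024854946718750,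
        514571775781008443860914515625, 701070583204337657336072925000,
        705699798208362184690220280000, 520071894077050333870244692500,
        273253382139001083645129160875, 97250865505141046982507245750,
        21126540784240872648996288250, 2130158083287674892136319000],
       [2420227138555273437500000000, 22367989901311697382812500000,
        98804546541064239380035156250, 276352633632037095613407665625,
        540778015029157881092546430000, 768348648997431478181769574500,
        798700938433434343944279720150, 601605255914624321368991826825,
        320132882790260033069250930300, 114528871577402042152122266450,
        24859256518766192386161304300, 2492527292293675217469707600],
       [1062312375892187500000000000, 10138958709890023943750000000,
        46828687553645929960270000000, 137520172948122822057857162625,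
        281292635672348970384634093125, 413840166489485755053591694035,
        440838991317919943103741178005, 337224353666537617707296783400,
        180978005701076261680101263250, 64963183317890956160220601000,
        14094973837397463257210719160, 1408801758284754266641012480],
       [182849525515625000000000000, 1818154188936171287500000000, 8834923363452751968470000000,
        27257969756881960539996498450, 58040132389469622279711377850,
        87879122293751829845321269866, 95377366138674237627649949466,
        73775778969160349744497878540, 39827554028965998402260953020,
        14331611474451296757633185240, 3110357068075234093762690096, 310551917358095857586138336]]
    have hc : (0 : ℝ) ≤ 1 / 254186582832900000000000 := by norm_num
    refine (mul_nonneg (mul_nonneg hc h3) h).trans_eq ?_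
    simp only [bernsteinForm₂, bernsteinForm, List.length_cons, List.length_nil]
    ring

theorem exists_comparison_scale {u a : ℝ} (hu : 0 < u) (ha : 0 ≤ a) :
    ∃ w, IsComparisonScale u a w := by
  rcases le_total u 1.52 with h152 | h152
  · rcases le_total a 0.6 with h06 | h06
    · rcases le_total u 1.05 with h105 | h105
      · exact ⟨_, isComparisonScale_of_le_of_le hu.le h105 ha h06⟩
      · rcases le_total u 1.25 with h125 | h125
        · exact ⟨_, isComparisonScale_sqrt_of_mem_105_125 h105 h125 ha h06⟩
        · exact ⟨_, isComparisonScale_sqrt_of_mem_125_152 h125 h152 ha h06⟩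
    · rcases le_total u 1 with h1 | h1
      · exact ⟨_, isComparisonScale_of_le_one hu.le h1 h06⟩
      · rcases le_total u 1.25 with h125 | h125
        · exact ⟨_, isComparisonScale_of_mem_1_125 h1 h125 h06⟩
        · exact ⟨_, isComparisonScale_of_mem_125_152 h125 h152 h06⟩
  · exact ⟨_, isComparisonScale_of_ge h152 ha⟩

theorem stmt17 (β₁ : ℝ) (hβ₁ : 1 < β₁)
    (hmono : ∀ μ σ : ℝ, 0 < μ → 0 < σ →
      AntitoneOn (fun b : ℝ => alpha12 μ σ β₁ b / alpha1 μ β₁ b) (Set.Ici β₁)) :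
    ∀ β₂ : ℝ, β₁ ≤ β₂ → ∀ μ σ η : ℝ, 0 < μ → 0 < σ → 0 < η →
      Eff η μ β₁ β₂ (σ ^ 2) ≤
        (1 / β₁) * sSup {y : ℝ | ∃ μ' σ' : ℝ, 0 < μ' ∧ 0 < σ' ∧ y = EffPM μ' (σ' ^ 2)} := by
  intro β₂ hβ₂ μ σ η hμ hσ hη
  have hβ0 : 0 < β₁ := by linarith
  have hu : 0 < μ / 2 := by positivity
  obtain ⟨w, hw, h1, h2⟩ := exists_comparison_scale hu
    (mul_nonneg (sub_nonneg.2 hβ₁.le) hu.le : 0 ≤ (β₁ - 1) * (μ / 2))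
  rw [show μ / 2 + (β₁ - 1) * (μ / 2) = β₁ * (μ / 2) by ring,
    show μ / 2 + 2 * ((β₁ - 1) * (μ / 2)) = (2 * β₁ - 1) * (μ / 2) by ring] at h1 h2
  have hmain := alpha12_div_alpha1_self_le hβ₁ hu hσ hw h1 h2
  rw [show 2 * (μ / 2) = μ by ring] at hmain
  have hα1 := alpha1_pos μ β₁ β₂
  have hα12 := alpha12_nonneg μ σ β₁ β₂
  calc Eff η μ β₁ β₂ (σ ^ 2)
      = μ ^ 2 * σ ^ 2 * alpha12 μ σ β₁ β₂ / (η * σ ^ 2 + alpha1 μ β₁ β₂) := by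
        rw [Eff, sqrt_sq hσ.le]
    _ ≤ μ ^ 2 * σ ^ 2 * alpha12 μ σ β₁ β₂ / alpha1 μ β₁ β₂ := by
        gcongr
        exact le_add_of_nonneg_left (by positivity)
    _ = μ ^ 2 * σ ^ 2 * (alpha12 μ σ β₁ β₂ / alpha1 μ β₁ β₂) := by ring
    _ ≤ μ ^ 2 * σ ^ 2 * (alpha12 μ σ β₁ β₁ / alpha1 μ β₁ β₁) := by
        have := hmono μ σ hμ hσ self_mem_Ici hβ₂ hβ₂
        gcongr
    _ ≤ 1 / β₁ * EffPM (2 * w) (σ ^ 2) := hmain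
    _ ≤ _ := by
        gcongr
        exact le_csSup bddAbove_effPM ⟨2 * w, σ, by positivity, hσ, rfl⟩
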